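/- arXiv:1207.2843 — 2 statements merged into one kernel-verified Lean document; each statement's English description precedes it below -/
import Mathlib

section
/- Fix d ≥ 1 and c > 0. Let ℓ²(ℤ^d) be the complex Hilbert space of square-summable functions on ℤ^d, and for ω : ℤ^d → ℝ let H_ω be the bounded self-adjoint operator (H_ω f)(x) = 2d·f(x) − Σ_{n∈ℤ^d, ‖n‖₁=1} f(x+n) + ω(x) f(x). Equip Ω = ℤ^d → ℝ with the product probability measure ℙ = ⊗_{i∈ℤ^d} μ, where μ is the uniform (normalized Lebesgue) measure on [-c,c]. If there exists ψ ∈ ℓ²(ℤ^d) such that ψ is cyclic for H_ω for ℙ-almost every ω, then for every nonzero φ ∈ ℓ²(ℤ^d), φ is cyclic for H_ω for ℙ-almost every ω. -/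
open MeasureTheory

namespace CyclicAux
open AddCircle Filter Topology ComplexConjugate

abbrev TT := AddCircle (1:ℝ)
noncomputable abbrev hh : Measure TT := haarAddCircle

/-- The characters of the two-torus. -/
noncomputable def ee (r : ℤ × ℤ) : C(TT × TT, ℂ) :=
  ⟨fun z => fourier r.1 z.1 * fourier r.2 z.2, by fun_prop⟩

lemma ee_apply (r : ℤ × ℤ) (z : TT × TT) : ee r z = fourier r.1 z.1 * fourier r.2 z.2 := rfl

lemma ee_add (r s : ℤ × ℤ) : ee (r + s) = ee r * ee s := by
  ext z
  simp only [ee_apply, ContinuousMap.mul_apply, Prod.fst_add, Prod.snd_add, fourier_add]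
  ring

lemma ee_zero : ee 0 = 1 := by
  ext z; simp [ee_apply]

lemma ee_neg (r : ℤ × ℤ) : ee (-r) = star (ee r) := by
  ext z
  simp [ee_apply, ContinuousMap.star_apply]

lemma norm_ee (r : ℤ × ℤ) (z) : ‖ee r z‖ = 1 := by
  rw [ee_apply, norm_mul, fourier_apply, fourier_apply, Circle.norm_coe, Circle.norm_coe, one_mul]

lemma int_fourier (n : ℤ) : ∫ x, fourier n x ∂hh = if n = 0 then 1 else 0 := by
  have := congrFun (fourierCoeff_fourier (T := 1) n) 0
  simp only [fourierCoeff, neg_zero, fourier_zero, one_smul] at this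
  rw [this, Pi.single_apply]; simp [eq_comm]

lemma int_ee (r : ℤ × ℤ) : ∫ z, ee r z ∂(hh.prod hh) = if r = 0 then 1 else 0 := by
  simp only [ee_apply]
  rw [integral_prod_mul, int_fourier, int_fourier]
  rcases r with ⟨a, b⟩
  by_cases ha : a = 0 <;> by_cases hb : b = 0 <;> simp [ha, hb]

lemma ae_zero_of_cont {X : Type*} [TopologicalSpace X] [CompactSpace X] [HasOuterApproxClosed X]
    [MeasurableSpace X] [BorelSpace X] (m : Measure X) [IsFiniteMeasure m] (h : X → ℂ)
    (hi : Integrable h m) (H : ∀ g : C(X, ℂ), ∫ x, g x * h x ∂m = 0) : h =ᵐ[m] 0 := by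
  have key : ∀ u : X → ℝ, Integrable u m → (∀ g : C(X, ℝ), ∫ x, g x * u x ∂m = 0) → u =ᵐ[m] 0 := by
    intro u hu hg
    have hfin : ∀ v : X → ℝ, Integrable v m → IsFiniteMeasure (m.withDensity fun x => ENNReal.ofReal (v x)) :=
      fun v hv => isFiniteMeasure_withDensity_ofReal hv.2
    have := hfin u hu
    have := hfin _ hu.neg
    have hI : ∀ v : X → ℝ, Integrable v m → ∀ g : BoundedContinuousFunction X ℝ,
        ∫ x, g x ∂(m.withDensity fun x => ENNReal.ofReal (v x)) = ∫ x, g x * max (v x) 0 ∂m := by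
      intro v hv g
      rw [integral_withDensity_eq_integral_toReal_smul₀ hv.1.aemeasurable.ennreal_ofReal (by simp)]
      apply integral_congr_ae
      filter_upwards with x
      rw [ENNReal.toReal_ofReal', smul_eq_mul, mul_comm]
    have heq : (m.withDensity fun x => ENNReal.ofReal (u x))
        = m.withDensity fun x => ENNReal.ofReal ((-u) x) := by
      apply ext_of_forall_integral_eq_of_IsFiniteMeasure
      intro g
      rw [hI u hu, hI _ hu.neg, ← sub_eq_zero, ← integral_sub]
      · refine Eq.trans ?_ (hg g.toContinuousMap)
        apply integral_congr_ae
        filter_upwards with x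
        simp only [Pi.neg_apply, BoundedContinuousFunction.coe_toContinuousMap]
        rw [← mul_sub, max_zero_sub_eq_self]
      · exact (hu.pos_part).bdd_mul (c := ‖g‖) g.continuous.aestronglyMeasurable
          (ae_of_all _ fun x => g.norm_coe_le_norm x)
      · exact (hu.neg.pos_part).bdd_mul (c := ‖g‖) g.continuous.aestronglyMeasurable
          (ae_of_all _ fun x => g.norm_coe_le_norm x)
    have := (withDensity_eq_iff hu.1.aemeasurable.ennreal_ofReal hu.neg.1.aemeasurable.ennreal_ofReal
      hu.lintegral_lt_top.ne).1 heq
    filter_upwards [this] with x hx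
    simp only [Pi.neg_apply] at hx
    rcases le_total (u x) 0 with h | h
    · rw [ENNReal.ofReal_of_nonpos h] at hx
      have := ENNReal.ofReal_eq_zero.1 hx.symm
      simp; linarith
    · rw [ENNReal.ofReal_of_nonpos (p := -u x) (by linarith)] at hx
      have := ENNReal.ofReal_eq_zero.1 hx
      simp; linarith
  have hgi : ∀ g : C(X, ℂ), Integrable (fun x => g x * h x) m := fun g =>
    hi.bdd_mul (c := ‖g‖) g.continuous.aestronglyMeasurable (ae_of_all _ fun x => g.norm_coe_le_norm x)
  have h1 := key (fun x => (h x).re) hi.re (fun g => by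
    have := congrArg Complex.re (H ⟨fun x => (g x : ℂ), by fun_prop⟩)
    have h2 := integral_re (hgi ⟨fun x => (g x : ℂ), by fun_prop⟩)
    simp only [RCLike.re_eq_complex_re] at h2
    rw [← h2] at this
    simpa using this)
  have h2 := key (fun x => (h x).im) hi.im (fun g => by
    have := congrArg Complex.im (H ⟨fun x => (g x : ℂ), by fun_prop⟩)
    have h2 := integral_im (hgi ⟨fun x => (g x : ℂ), by fun_prop⟩)
    simp only [RCLike.im_eq_complex_im] at h2
    rw [← h2] at this
    simpa using this)
  filter_upwards [h1, h2] with x a b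
  exact Complex.ext a b

lemma ae_zero_of_dense {X : Type*} [TopologicalSpace X] [CompactSpace X] [HasOuterApproxClosed X]
    [MeasurableSpace X] [BorelSpace X] (m : Measure X) [IsFiniteMeasure m] (h : X → ℂ)
    (hi : Integrable h m) (S : Set C(X, ℂ)) (hS : (Submodule.span ℂ S).topologicalClosure = ⊤)
    (H : ∀ g ∈ S, ∫ x, g x * h x ∂m = 0) : h =ᵐ[m] 0 := by
  have hgi : ∀ g : C(X, ℂ), Integrable (fun x => g x * h x) m := fun g =>
    hi.bdd_mul (c := ‖g‖) g.continuous.aestronglyMeasurable (ae_of_all _ fun x => g.norm_coe_le_norm x)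
  apply ae_zero_of_cont m h hi
  intro g
  let L : C(X, ℂ) →ₗ[ℂ] ℂ :=
    { toFun := fun g => ∫ x, g x * h x ∂m
      map_add' := fun a b => by
        rw [← integral_add (hgi a) (hgi b)]; congr 1; ext x; simp [add_mul]
      map_smul' := fun c a => by
        simp only [RingHom.id_apply, smul_eq_mul]
        rw [← integral_const_mul]; congr 1; ext x; simp [mul_assoc] }
  let L' : C(X, ℂ) →L[ℂ] ℂ := L.mkContinuous (∫ x, ‖h x‖ ∂m) (fun g => by
    calc ‖∫ x, g x * h x ∂m‖ ≤ ∫ x, ‖g x * h x‖ ∂m := norm_integral_le_integral_norm _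
      _ ≤ ∫ x, ‖h x‖ * ‖g‖ ∂m := by
        apply integral_mono (hgi g).norm (hi.norm.mul_const _)
        intro x
        simp only [norm_mul]
        rw [mul_comm]
        gcongr
        exact g.norm_coe_le_norm x
      _ = _ := integral_mul_const _ _)
  have hk : Submodule.span ℂ S ≤ L'.ker := by
    rw [Submodule.span_le]; intro g hg
    simp only [SetLike.mem_coe, LinearMap.mem_ker]
    exact H g hg
  have := Submodule.topologicalClosure_minimal _ hk L'.isClosed_ker
  rw [hS] at this
  exact this (Submodule.mem_top (x := g))

lemma span_ee_dense : (Submodule.span ℂ (Set.range ee)).topologicalClosure = ⊤ := by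
  have hmul : ∀ a ∈ Submodule.span ℂ (Set.range ee), ∀ b ∈ Submodule.span ℂ (Set.range ee),
      a * b ∈ Submodule.span ℂ (Set.range ee) := by
    intro a ha b hb
    have := Submodule.mul_mem_mul ha hb
    rw [Submodule.span_mul_span] at this
    refine Submodule.span_mono ?_ this
    rintro _ ⟨_, ⟨r, rfl⟩, _, ⟨s, rfl⟩, rfl⟩
    exact ⟨r + s, ee_add r s⟩
  have hstar : ∀ a ∈ Submodule.span ℂ (Set.range ee), star a ∈ Submodule.span ℂ (Set.range ee) := by
    intro a ha
    induction ha using Submodule.span_induction with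
    | mem x hx =>
      obtain ⟨r, rfl⟩ := hx
      exact Submodule.subset_span ⟨-r, ee_neg r⟩
    | zero => simp
    | add x y _ _ hx hy => rw [star_add]; exact Submodule.add_mem _ hx hy
    | smul c x _ hx => rw [star_smul]; exact Submodule.smul_mem _ _ hx
  let A : StarSubalgebra ℂ C(TT × TT, ℂ) :=
    { carrier := Submodule.span ℂ (Set.range ee)
      mul_mem' := fun {a b} ha hb => hmul a ha b hb
      add_mem' := fun {a b} ha hb => Submodule.add_mem _ ha hb
      algebraMap_mem' := fun c => by
        rw [Algebra.algebraMap_eq_smul_one]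
        exact Submodule.smul_mem _ _ (Submodule.subset_span ⟨0, ee_zero⟩)
      star_mem' := fun {a} ha => hstar a ha }
  have hsep : A.SeparatesPoints := by
    intro x y hxy
    have : x.1 ≠ y.1 ∨ x.2 ≠ y.2 := by
      by_contra hc; push Not at hc; exact hxy (Prod.ext hc.1 hc.2)
    rcases this with h | h
    · refine ⟨_, ⟨ee (1, 0), Submodule.subset_span ⟨_, rfl⟩, rfl⟩, ?_⟩
      simp only [ee_apply, fourier_one, fourier_zero, mul_one]
      intro hc; exact h (injective_toCircle one_ne_zero (Subtype.ext hc))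
    · refine ⟨_, ⟨ee (0, 1), Submodule.subset_span ⟨_, rfl⟩, rfl⟩, ?_⟩
      simp only [ee_apply, fourier_one, fourier_zero, one_mul]
      intro hc; exact h (injective_toCircle one_ne_zero (Subtype.ext hc))
  have := ContinuousMap.starSubalgebra_topologicalClosure_eq_top_of_separatesPoints A hsep
  rw [eq_top_iff]
  intro x _
  have hx : x ∈ A.topologicalClosure := by rw [this]; trivial
  exact hx

end CyclicAux

open MeasureTheory

namespace CyclicAux
open AddCircle Filter Topology ComplexConjugate

lemma card_shift (N : ℕ) (r : ℤ) (h : |r| ≤ N) :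
    (((Finset.Ico (0:ℤ) N).filter (fun a => r + a ∈ Finset.Ico (0:ℤ) N)).card : ℝ) = N - |r| := by
  have : (Finset.Ico (0:ℤ) N).filter (fun a => r + a ∈ Finset.Ico (0:ℤ) N)
      = Finset.Ico (max 0 (-r)) (min N (N - r)) := by
    ext a; simp only [Finset.mem_filter, Finset.mem_Ico]; omega
  rw [this, Int.card_Ico]
  have h2 : ((min (N:ℤ) (N - r) - max 0 (-r)).toNat : ℤ) = N - |r| := by
    rcases abs_cases r with ⟨h1, h3⟩ | ⟨h1, h3⟩ <;> omega
  exact_mod_cast h2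

noncomputable def box (N : ℕ) : Finset (ℤ × ℤ) := Finset.Ico (0:ℤ) N ×ˢ Finset.Ico (0:ℤ) N

lemma card_box_shift (r : ℤ × ℤ) :
    Tendsto (fun N : ℕ => (((box N).filter (fun p => r + p ∈ box N)).card : ℝ) / (N:ℝ)^2) atTop (𝓝 1) := by
  have h1 : Tendsto (fun N : ℕ => (1 - (|r.1| : ℤ) / (N:ℝ)) * (1 - (|r.2| : ℤ) / (N:ℝ))) atTop
      (𝓝 ((1 - 0) * (1 - 0))) := by
    apply Tendsto.mul
    · exact tendsto_const_nhds.sub (tendsto_const_div_atTop_nhds_zero_nat _)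
    · exact tendsto_const_nhds.sub (tendsto_const_div_atTop_nhds_zero_nat _)
  simp only [sub_zero, mul_one] at h1
  refine h1.congr' ?_
  filter_upwards [eventually_ge_atTop (r.1.natAbs + r.2.natAbs + 1)] with N hN
  have e : (box N).filter (fun p => r + p ∈ box N)
      = (Finset.Ico (0:ℤ) N).filter (fun a => r.1 + a ∈ Finset.Ico (0:ℤ) N) ×ˢ
        (Finset.Ico (0:ℤ) N).filter (fun a => r.2 + a ∈ Finset.Ico (0:ℤ) N) := by
    ext p
    simp only [box, Finset.mem_filter, Finset.mem_product, Prod.fst_add, Prod.snd_add]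
    tauto
  rw [e, Finset.card_product, Nat.cast_mul, card_shift N _ (by rw [Int.abs_eq_natAbs]; omega),
    card_shift N _ (by rw [Int.abs_eq_natAbs]; omega)]
  have : (N:ℝ) ≠ 0 := by
    have : 0 < N := by omega
    positivity
  field_simp

open scoped ComplexOrder in
theorem herglotz (c : ℤ × ℤ → ℂ) (c0 : c 0 = 1)
    (hpos : ∀ (s : Finset (ℤ × ℤ)) (z : ℤ × ℤ → ℂ),
      0 ≤ ∑ p ∈ s, ∑ q ∈ s, conj (z p) * z q * c (q - p)) :
    ∃ m : Measure (TT × TT), IsProbabilityMeasure m ∧ ∀ r, ∫ z, ee r z ∂m = c r := by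
  let D : ℕ → C(TT × TT, ℂ) := fun N =>
    ((N:ℂ)^2)⁻¹ • ∑ p ∈ box N, ∑ q ∈ box N, c (q - p) • ee (p - q)
  have hD0 : ∀ N z, 0 ≤ D N z := by
    intro N z
    have h1 := hpos (box N) (fun p => ee (-p) z)
    have h2 : D N z = ((((N:ℝ)^2)⁻¹ : ℝ) : ℂ) *
        ∑ p ∈ box N, ∑ q ∈ box N, conj (ee (-p) z) * ee (-q) z * c (q - p) := by
      simp only [D, ContinuousMap.smul_apply, ContinuousMap.sum_apply, smul_eq_mul]
      push_cast
      congr 1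
      refine Finset.sum_congr rfl fun p _ => Finset.sum_congr rfl fun q _ => ?_
      rw [sub_eq_add_neg p q, ee_add, ee_neg p]
      simp only [ContinuousMap.mul_apply, ContinuousMap.star_apply, RCLike.star_def, Complex.conj_conj]
      ring
    rw [h2]
    apply mul_nonneg _ h1
    rw [Complex.zero_le_real]; positivity
  have hDre : ∀ N z, ((D N z).re : ℂ) = D N z := fun N z =>
    Complex.ext rfl ((Complex.nonneg_iff.1 (hD0 N z)).2)
  have hint : ∀ N r, ∫ z, ee r z * D N z ∂(hh.prod hh)
      = c r * ((((box N).filter (fun p => r + p ∈ box N)).card / (N:ℝ)^2 : ℝ) : ℂ) := by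
    intro N r
    have ci : ∀ g : C(TT × TT, ℂ), Integrable g (hh.prod hh) := fun g =>
      g.continuous.integrable_of_hasCompactSupport (HasCompactSupport.of_compactSpace _)
    have : ∀ z, ee r z * D N z
        = ((N:ℂ)^2)⁻¹ * ∑ p ∈ box N, ∑ q ∈ box N, c (q - p) * ee (r + p - q) z := by
      intro z
      simp only [D, ContinuousMap.smul_apply, ContinuousMap.sum_apply, smul_eq_mul, Finset.mul_sum]
      refine Finset.sum_congr rfl fun p _ => Finset.sum_congr rfl fun q _ => ?_
      rw [add_sub_assoc, ee_add, ContinuousMap.mul_apply]; ring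
    simp_rw [this]
    rw [integral_const_mul, integral_finsetSum _ (fun p _ =>
      integrable_finsetSum _ fun q _ => (ci _).const_mul _)]
    have h3 : ∀ p ∈ box N, ∫ z, ∑ q ∈ box N, c (q - p) * ee (r + p - q) z ∂(hh.prod hh)
        = if r + p ∈ box N then c r else 0 := by
      intro p _
      rw [integral_finsetSum _ (fun q _ => (ci _).const_mul _)]
      simp_rw [integral_const_mul, int_ee, sub_eq_zero]
      simp [Finset.sum_ite_eq]
    rw [Finset.sum_congr rfl h3, ← Finset.sum_filter, Finset.sum_const]
    push_cast
    simp only [nsmul_eq_mul]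
    field_simp
  have hcont : ∀ N, Continuous fun z => (D N z).re := fun N => by fun_prop
  have hone : ∀ N : ℕ, 0 < N → IsProbabilityMeasure
      ((hh.prod hh).withDensity fun z => ENNReal.ofReal (D N z).re) := by
    intro N hN
    constructor
    rw [withDensity_apply _ MeasurableSet.univ, Measure.restrict_univ,
      ← ofReal_integral_eq_lintegral_ofReal]
    · have h1 := hint N 0
      have h2 : ((∫ z, (D N z).re ∂(hh.prod hh) : ℝ) : ℂ) = 1 := by
        rw [← integral_complex_ofReal]
        simp_rw [hDre]
        simp only [ee_zero, ContinuousMap.one_apply, one_mul, zero_add, c0] at h1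
        rw [h1]
        have : (box N).filter (fun p => p ∈ box N) = box N := by ext; simp
        rw [this]
        simp only [box, Finset.card_product, Int.card_Ico, sub_zero, Int.toNat_natCast, Nat.cast_mul]
        have : (N:ℝ) ≠ 0 := by positivity
        norm_cast
        field_simp
        push_cast; ring
      have h3 : ∫ z, (D N z).re ∂(hh.prod hh) = 1 := by exact_mod_cast h2
      rw [h3]; simp
    · exact (hcont N).integrable_of_hasCompactSupport (HasCompactSupport.of_compactSpace _)
    · exact ae_of_all _ fun z => (Complex.nonneg_iff.1 (hD0 N z)).1
  let M : ℕ → ProbabilityMeasure (TT × TT) := fun N => ⟨_, hone (N+1) N.succ_pos⟩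
  have hM : ∀ r, Tendsto (fun N => ∫ z, ee r z ∂(M N : Measure (TT × TT))) atTop (𝓝 (c r)) := by
    intro r
    have h1 : ∀ N, ∫ z, ee r z ∂(M N : Measure (TT × TT)) = ∫ z, ee r z * D (N+1) z ∂(hh.prod hh) := by
      intro N
      change ∫ z, ee r z ∂((hh.prod hh).withDensity fun z => ENNReal.ofReal (D (N+1) z).re) = _
      rw [integral_withDensity_eq_integral_toReal_smul ((hcont (N+1)).measurable.ennreal_ofReal) (by simp)]
      congr 1; ext z
      rw [ENNReal.toReal_ofReal (Complex.nonneg_iff.1 (hD0 (N+1) z)).1, Complex.real_smul, hDre, mul_comm]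
    simp_rw [h1, hint]
    have h2 := ((card_box_shift r).comp (tendsto_add_atTop_nat 1))
    have h3 := (Complex.continuous_ofReal.tendsto 1).comp h2
    have h4 := h3.const_mul (c r)
    simp only [Complex.ofReal_one, mul_one] at h4
    exact h4
  let F : Ultrafilter ℕ := Ultrafilter.of atTop
  have hF : (F : Filter ℕ) ≤ atTop := Ultrafilter.of_le _
  obtain ⟨m, -, hm⟩ := isCompact_univ.ultrafilter_le_nhds (F.map M) (by simp)
  have hm : Tendsto M F (𝓝 m) := hm
  rw [ProbabilityMeasure.tendsto_iff_forall_integral_tendsto] at hm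
  refine ⟨m, inferInstance, fun r => ?_⟩
  have ci : ∀ (ρ : ProbabilityMeasure (TT × TT)) , Integrable (ee r) (ρ : Measure (TT × TT)) := fun ρ =>
      (ee r).continuous.integrable_of_hasCompactSupport (HasCompactSupport.of_compactSpace _)
  have hr : Tendsto (fun i => ∫ z, (ee r z).re ∂(M i : Measure (TT × TT))) F
    (𝓝 (∫ z, (ee r z).re ∂(m : Measure (TT × TT)))) := hm (BoundedContinuousFunction.mkOfCompact ⟨fun z => (ee r z).re, by fun_prop⟩)
  have hi : Tendsto (fun i => ∫ z, (ee r z).im ∂(M i : Measure (TT × TT))) F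
    (𝓝 (∫ z, (ee r z).im ∂(m : Measure (TT × TT)))) := hm (BoundedContinuousFunction.mkOfCompact ⟨fun z => (ee r z).im, by fun_prop⟩)
  have e1 : ∀ ρ : ProbabilityMeasure (TT × TT), ∫ z, (ee r z).re ∂(ρ : Measure (TT × TT))
      = (∫ z, ee r z ∂(ρ : Measure (TT × TT))).re := fun ρ => integral_re (ci ρ)
  have e2 : ∀ ρ : ProbabilityMeasure (TT × TT), ∫ z, (ee r z).im ∂(ρ : Measure (TT × TT))
      = (∫ z, ee r z ∂(ρ : Measure (TT × TT))).im := fun ρ => integral_im (ci ρ)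
  simp_rw [e1] at hr
  simp_rw [e2] at hi
  have k1 := (Complex.continuous_re.tendsto _).comp ((hM r).mono_left hF)
  have k2 := (Complex.continuous_im.tendsto _).comp ((hM r).mono_left hF)
  exact Complex.ext (tendsto_nhds_unique hr k1) (tendsto_nhds_unique hi k2)

end CyclicAux

open MeasureTheory

namespace CyclicAux
open AddCircle Filter Topology ComplexConjugate

section mulC
variable {X : Type*} [TopologicalSpace X] [CompactSpace X] [MeasurableSpace X] [BorelSpace X]
  [SecondCountableTopologyEither X ℂ]

lemma memLp_mulC (m : Measure X) (g : C(X, ℂ)) {f : X → ℂ} (hf : MemLp f 2 m) :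
    MemLp (fun x => g x * f x) 2 m := by
  refine hf.of_le_mul (c := ‖g‖) (g.continuous.aestronglyMeasurable.mul hf.1) (ae_of_all _ fun x => ?_)
  rw [norm_mul]; gcongr; exact g.norm_coe_le_norm x

/-- Multiplication by a continuous function on `L²`. -/
noncomputable def mulC (m : Measure X) (g : C(X, ℂ)) : Lp ℂ 2 m →L[ℂ] Lp ℂ 2 m :=
  LinearMap.mkContinuous
    { toFun := fun f => (memLp_mulC m g (Lp.memLp f)).toLp _
      map_add' := fun a b => by
        apply Lp.ext
        filter_upwards [(memLp_mulC m g (Lp.memLp (a+b))).coeFn_toLp,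
          (memLp_mulC m g (Lp.memLp a)).coeFn_toLp, (memLp_mulC m g (Lp.memLp b)).coeFn_toLp,
          Lp.coeFn_add a b, Lp.coeFn_add ((memLp_mulC m g (Lp.memLp a)).toLp _)
            ((memLp_mulC m g (Lp.memLp b)).toLp _)] with x h1 h2 h3 h4 h5
        rw [h1, h5, Pi.add_apply, h2, h3, h4, Pi.add_apply, mul_add]
      map_smul' := fun c a => by
        apply Lp.ext
        filter_upwards [(memLp_mulC m g (Lp.memLp (c • a))).coeFn_toLp,
          (memLp_mulC m g (Lp.memLp a)).coeFn_toLp,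
          Lp.coeFn_smul c a, Lp.coeFn_smul c ((memLp_mulC m g (Lp.memLp a)).toLp _)] with x h1 h2 h4 h5
        rw [h1, RingHom.id_apply, h5, Pi.smul_apply, h2, h4, Pi.smul_apply, smul_eq_mul, smul_eq_mul]
        ring }
    ‖g‖ (fun f => by
      apply Lp.norm_le_mul_norm_of_ae_le_mul
      simp only [LinearMap.coe_mk, AddHom.coe_mk]
      filter_upwards [(memLp_mulC m g (Lp.memLp f)).coeFn_toLp] with x h1
      rw [h1, norm_mul]; gcongr; exact g.norm_coe_le_norm x)

lemma mulC_coe (m : Measure X) (g : C(X, ℂ)) (f : Lp ℂ 2 m) :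
    mulC m g f =ᵐ[m] fun x => g x * f x :=
  (memLp_mulC m g (Lp.memLp f)).coeFn_toLp

end mulC

lemma inner_Lp {X : Type*} [MeasurableSpace X] {m : Measure X} (f g : Lp ℂ 2 m) :
    inner ℂ f g = ∫ x, conj (f x) * g x ∂m := by
  rw [L2.inner_def]; congr 1; ext x; simp [mul_comm]

/-- Uniqueness theorem of F. and M. Riesz (L² version). -/
theorem riesz_unique (G : TT → ℂ) (hG : MemLp G 2 hh)
    (h1 : ∀ n : ℕ, ∫ x, fourier (-((n:ℤ)+1)) x * G x ∂hh = 0)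
    (h2 : ∃ n : ℤ, ∫ x, fourier n x * G x ∂hh ≠ 0) : ∀ᵐ x ∂hh, G x ≠ 0 := by
  obtain ⟨g, hg⟩ : ∃ g : Lp ℂ 2 hh, g =ᵐ[hh] G := ⟨hG.toLp G, hG.coeFn_toLp⟩
  obtain ⟨V, hV⟩ : ∃ V : ℤ → (Lp ℂ 2 hh →L[ℂ] Lp ℂ 2 hh),
      ∀ n f, V n f =ᵐ[hh] fun x => fourier n x * f x :=
    ⟨fun n => mulC hh (fourier n), fun n f => mulC_coe _ _ _⟩
  obtain ⟨one, hone⟩ : ∃ g : Lp ℂ 2 hh, g =ᵐ[hh] fun _ => 1 :=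
    ⟨(memLp_const (1:ℂ)).toLp _, (memLp_const (μ := hh) (p := 2) (1:ℂ)).coeFn_toLp⟩
  have hVV : ∀ n k f, V n (V k f) = V (n + k) f := by
    intro n k f
    apply Lp.ext
    filter_upwards [hV n (V k f), hV k f, hV (n+k) f] with x a b c
    rw [a, b, c, fourier_add]; ring
  have hinner : ∀ n k (f f' : Lp ℂ 2 hh), inner ℂ (V n f) (V k f') = ∫ x, fourier (k - n) x * (conj (f x) * f' x) ∂hh := by
    intro n k f f'
    rw [inner_Lp]
    apply integral_congr_ae
    filter_upwards [hV n f, hV k f'] with x a b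
    rw [a, b, sub_eq_add_neg, fourier_add, fourier_neg, map_mul]; ring
  obtain ⟨K, hKc, hmemK, hKmin⟩ : ∃ K : ℤ → Submodule ℂ (Lp ℂ 2 hh),
      (∀ j, IsClosed (K j : Set (Lp ℂ 2 hh))) ∧ (∀ j (n : ℕ), V (-((n:ℤ)+j)) g ∈ K j) ∧
      ∀ j (L : Submodule ℂ (Lp ℂ 2 hh)), IsClosed (L : Set (Lp ℂ 2 hh)) →
        (∀ n : ℕ, V (-((n:ℤ)+j)) g ∈ L) → K j ≤ L := by
    refine ⟨fun j => (Submodule.span ℂ (Set.range fun n : ℕ => V (-((n:ℤ)+j)) g)).topologicalClosure,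
      fun j => Submodule.isClosed_topologicalClosure _, fun j n =>
        Submodule.le_topologicalClosure _ (Submodule.subset_span ⟨n, rfl⟩), fun j L hL h => ?_⟩
    apply Submodule.topologicalClosure_minimal _ _ hL
    rw [Submodule.span_le]
    rintro _ ⟨n, rfl⟩
    exact h n
  have : ∀ j, CompleteSpace (K j) := fun j => (hKc j).completeSpace_coe
  have hK10 : K 1 ≤ K 0 := by
    apply hKmin _ _ (hKc 0)
    intro n
    have := hmemK 0 (n+1)
    simpa using this
  have hVK : ∀ (n : ℕ), ∀ f ∈ K 0, V (-((n:ℤ)+1)) f ∈ K 1 := by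
    intro n
    have : K 0 ≤ (K 1).comap ((V (-((n:ℤ)+1))).toLinearMap) := by
      apply hKmin
      · exact (hKc 1).preimage (V (-((n:ℤ)+1))).continuous
      · intro k
        rw [Submodule.mem_comap, ContinuousLinearMap.coe_coe, hVV]
        have := hmemK 1 (n + k)
        convert this using 3
        push_cast; ring
    exact fun f hf => this hf
  have hV0 : ∀ f, V 0 f = f := by
    intro f
    apply Lp.ext
    filter_upwards [hV 0 f] with x a
    rw [a]; simp
  have hg0 : g ∈ K 0 := by
    have := hmemK 0 0
    simpa [hV0] using this
  obtain ⟨q, hqdef⟩ : ∃ q, q = g - (K 1).starProjection g := ⟨_, rfl⟩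
  have hq1 : q ∈ (K 1)ᗮ := hqdef ▸ Submodule.sub_starProjection_mem_orthogonal g
  have hq0 : q ∈ K 0 := hqdef ▸ Submodule.sub_mem _ hg0 (hK10 (Submodule.starProjection_apply_mem _ _))
  have hqi : Integrable (fun x => conj (q x) * q x) hh := by
    have h := L2.integrable_inner (𝕜 := ℂ) q q
    refine h.congr (ae_of_all _ fun x => ?_)
    simp only [RCLike.inner_apply]
    ring
  -- `|q|²` is constant
  have hconst : ∀ᵐ x ∂hh, conj (q x) * q x - inner ℂ q q = 0 := by
    refine ae_zero_of_dense hh (fun x => conj (q x) * q x - inner ℂ q q) (hqi.sub (integrable_const _))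
      (Set.range fourier) span_fourier_closure_eq_top ?_
    rintro _ ⟨n, rfl⟩
    have hn : ∀ n : ℕ, ∫ x, fourier (-((n:ℤ)+1)) x * (conj (q x) * q x) ∂hh = 0 := by
      intro n
      have a := hinner 0 (-((n:ℤ)+1)) q q
      rw [sub_zero, hV0] at a
      rw [← a]
      exact Submodule.inner_left_of_mem_orthogonal (hVK n q hq0) hq1
    have hn' : ∀ n : ℕ, ∫ x, fourier ((n:ℤ)+1) x * (conj (q x) * q x) ∂hh = 0 := by
      intro n
      have a := hinner (-((n:ℤ)+1)) 0 q q
      rw [zero_sub, neg_neg, hV0] at a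
      rw [← a]
      exact Submodule.inner_right_of_mem_orthogonal (hVK n q hq0) hq1
    have hfi : Integrable (fun x => fourier n x * (conj (q x) * q x)) hh :=
      hqi.bdd_mul (c := ‖fourier (T := 1) n‖) (fourier n).continuous.aestronglyMeasurable
        (ae_of_all _ fun x => (fourier n).norm_coe_le_norm x)
    have hfc : Integrable (fun x => fourier n x * inner ℂ q q) hh :=
      ((fourier n).continuous.integrable_of_hasCompactSupport (HasCompactSupport.of_compactSpace _)).mul_const _
    simp_rw [mul_sub]
    rw [integral_sub hfi hfc, integral_mul_const, int_fourier]
    rcases lt_trichotomy n 0 with h | h | h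
    · obtain ⟨k, rfl⟩ : ∃ k : ℕ, n = -((k:ℤ)+1) := ⟨(-n-1).toNat, by omega⟩
      rw [hn, if_neg (by omega)]; simp
    · subst h
      rw [inner_Lp]; simp
    · obtain ⟨k, rfl⟩ : ∃ k : ℕ, n = ((k:ℤ)+1) := ⟨(n-1).toNat, by omega⟩
      rw [hn', if_neg (by omega)]; simp
  -- `q ≠ 0`
  have hq : q ≠ 0 := by
    intro hq
    have hgK : g ∈ K 1 := by
      have : g = (K 1).starProjection g := sub_eq_zero.1 (hqdef.symm.trans hq)
      rw [this]; exact Submodule.starProjection_apply_mem _ _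
    have hcoef : ∀ n f, inner ℂ (V (-n) one) f
        = ∫ x, fourier n x * f x ∂hh := by
      intro n f
      rw [inner_Lp]
      apply integral_congr_ae
      filter_upwards [hV (-n) one, hone] with x a b
      rw [a, b, fourier_neg]; simp
    have hz : ∀ n : ℕ, ∀ k : ℤ, k < n → ∫ x, fourier k x * g x ∂hh = 0 := by
      intro n
      induction n with
      | zero =>
        intro k hk
        obtain ⟨j, rfl⟩ : ∃ j : ℕ, k = -((j:ℤ)+1) := ⟨(-k-1).toNat, by push_cast at hk; omega⟩
        rw [← h1 j]
        apply integral_congr_ae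
        filter_upwards [hg] with x hx
        rw [hx]
      | succ n ih =>
        intro k hk
        by_cases hkn : k < n
        · exact ih k hkn
        have hkn : k = n := by push_cast at hk; omega
        subst hkn
        rw [← hcoef]
        have : K 1 ≤ (innerSL ℂ (V (-(n:ℤ)) one)).ker := by
          apply hKmin _ _ (ContinuousLinearMap.isClosed_ker _)
          · intro j
            rw [LinearMap.mem_ker, ContinuousLinearMap.coe_coe, innerSL_apply_apply]
            rw [hcoef, ← ih (n - (j + 1)) (by omega)]
            apply integral_congr_ae
            filter_upwards [hV (-((j:ℤ)+1)) g] with x a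
            rw [a, sub_eq_add_neg, fourier_add]; ring
        have h := this hgK
        rwa [LinearMap.mem_ker, ContinuousLinearMap.coe_coe, innerSL_apply_apply] at h
    obtain ⟨n, hn⟩ := h2
    apply hn
    rw [← hz (n.toNat + 1) n (by push_cast; omega)]
    apply integral_congr_ae
    filter_upwards [hg] with x hx
    rw [hx]
  -- `q` vanishes where `G` does
  have hfm : MemLp (Set.indicator {x | g x = 0} q) 2 hh :=
    (Lp.memLp q).indicator ((Lp.stronglyMeasurable g).measurable (measurableSet_singleton 0))
  have hE : ∀ᵐ x ∂hh, g x = 0 → q x = 0 := by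
    obtain ⟨k, hk⟩ : ∃ k : Lp ℂ 2 hh, k =ᵐ[hh] Set.indicator {x | g x = 0} q :=
      ⟨hfm.toLp _, hfm.coeFn_toLp⟩
    have : K 0 ≤ (innerSL ℂ k).ker := by
      apply hKmin _ _ (ContinuousLinearMap.isClosed_ker _)
      · intro j
        rw [LinearMap.mem_ker, ContinuousLinearMap.coe_coe, innerSL_apply_apply]
        rw [inner_Lp, ← integral_zero (G := ℂ) (μ := hh)]
        apply integral_congr_ae
        filter_upwards [hV (-((j:ℤ)+0)) g, hk] with x a b
        rw [a, b]
        by_cases hx : g x = 0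
        · simp [hx]
        · simp [Set.indicator, hx]
    have h0 : inner ℂ k q = 0 := by
      have h := this hq0
      rwa [LinearMap.mem_ker, ContinuousLinearMap.coe_coe, innerSL_apply_apply] at h
    have h3 : inner ℂ k k = 0 := by
      rw [← h0, inner_Lp, inner_Lp]
      apply integral_congr_ae
      filter_upwards [hk] with x b
      rw [b]
      by_cases hx : g x = 0
      · simp [Set.indicator, hx]
      · simp [Set.indicator, hx]
    have h4 : k = 0 := inner_self_eq_zero.1 h3
    have h5 : k =ᵐ[hh] 0 := by rw [h4]; exact Lp.coeFn_zero _ _ _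
    filter_upwards [hk, h5] with x a b hx
    rw [b] at a
    simpa [Set.indicator, hx] using a.symm
  filter_upwards [hg, hE, hconst] with x a b c hx
  rw [b (by rw [a, hx])] at c
  simp only [map_zero, mul_zero, zero_sub, neg_eq_zero] at c
  exact hq (inner_self_eq_zero.1 c)

end CyclicAux

open MeasureTheory

namespace CyclicAux
open AddCircle Filter Topology ComplexConjugate

lemma cesaro (y : ℂ) (hy : ‖y‖ ≤ 1) :
    Tendsto (fun N : ℕ => (N:ℂ)⁻¹ * ∑ k ∈ Finset.range N, y ^ k) atTop
      (𝓝 (if y = 1 then 1 else 0)) := by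
  split_ifs with h
  · subst h
    refine tendsto_const_nhds.congr' ?_
    filter_upwards [eventually_gt_atTop 0] with N hN
    have : (N:ℂ) ≠ 0 := by exact_mod_cast hN.ne'
    simp [this]
  · have h' : y - 1 ≠ 0 := sub_ne_zero.2 h
    rw [tendsto_zero_iff_norm_tendsto_zero]
    have hlim : Tendsto (fun N : ℕ => (N:ℝ)⁻¹ * (2 / ‖y - 1‖)) atTop (𝓝 0) := by
      simpa using (tendsto_inv_atTop_nhds_zero_nat (𝕜 := ℝ)).mul_const (2 / ‖y - 1‖)
    refine squeeze_zero (fun _ => norm_nonneg _) (fun N => ?_) hlim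
    rw [geom_sum_eq h, norm_mul, norm_inv, norm_div]
    simp only [Complex.norm_natCast]
    gcongr
    calc ‖y ^ N - 1‖ ≤ ‖y ^ N‖ + ‖(1:ℂ)‖ := norm_sub_le _ _
      _ ≤ 1 + 1 := by
        rw [norm_pow, norm_one]; gcongr; exact pow_le_one₀ (norm_nonneg _) hy
      _ = 2 := by norm_num

lemma norm_f (n : ℤ) (x : TT) : ‖fourier n x‖ = 1 := by
  rw [fourier_apply]; exact Circle.norm_coe _

lemma fourier_one_inj {x y : TT} (h : fourier 1 x = fourier 1 y) : x = y := by
  rw [fourier_one, fourier_one] at h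
  exact AddCircle.injective_toCircle one_ne_zero (Circle.ext h)

lemma fourier_pow (k : ℕ) (x : TT) : fourier (k:ℤ) x = (fourier 1 x) ^ k := by
  rw [fourier_apply, fourier_one, AddCircle.toCircle_zsmul]; simp

lemma wiener_atom (κ : Measure TT) [IsProbabilityMeasure κ] (Θ : ℂ)
    (hk : ∀ k : ℕ, ∫ x, fourier (k:ℤ) x ∂κ = Θ ^ k) (η : TT) (hη : fourier 1 η ≠ Θ) :
    κ {η} = 0 := by
  have hΘ : ‖Θ‖ ≤ 1 := by
    have := hk 1
    rw [pow_one] at this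
    rw [← this]
    refine (norm_integral_le_integral_norm _).trans ?_
    simp [-fourier_apply, norm_f]
  set y : TT → ℂ := fun x => conj (fourier 1 η) * fourier 1 x with hy
  have hyn : ∀ x, ‖y x‖ ≤ 1 := fun x => by
    simp only [hy, norm_mul, RCLike.norm_conj, norm_f]; norm_num
  have hηη : conj (fourier 1 η) * fourier 1 η = 1 := by
    rw [← fourier_neg, ← fourier_add]; simp
  have hyc : Continuous y := by
    exact continuous_const.mul (fourier 1).continuous
  have h1 : Tendsto (fun N : ℕ => ∫ x, (N:ℂ)⁻¹ * ∑ k ∈ Finset.range N, y x ^ k ∂κ) atTop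
      (𝓝 (∫ x, (if y x = 1 then 1 else 0) ∂κ)) := by
    refine tendsto_integral_of_dominated_convergence (fun _ => 1) ?_ (integrable_const _) ?_ ?_
    · intro N
      exact Continuous.aestronglyMeasurable (by fun_prop)
    · intro N
      refine ae_of_all _ fun x => ?_
      rw [norm_mul, norm_inv, Complex.norm_natCast]
      calc (N:ℝ)⁻¹ * ‖∑ k ∈ Finset.range N, y x ^ k‖ ≤ (N:ℝ)⁻¹ * ∑ k ∈ Finset.range N, 1 := by
            gcongr
            refine norm_sum_le_of_le _ fun k _ => ?_
            rw [norm_pow]; exact pow_le_one₀ (norm_nonneg _) (hyn x)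
        _ ≤ 1 := by
            simp only [Finset.sum_const, Finset.card_range, nsmul_eq_mul, mul_one]
            exact inv_mul_le_one
    · exact ae_of_all _ fun x => cesaro _ (hyn x)
  have h2 : ∀ N : ℕ, ∫ x, (N:ℂ)⁻¹ * ∑ k ∈ Finset.range N, y x ^ k ∂κ =
      (N:ℂ)⁻¹ * ∑ k ∈ Finset.range N, (conj (fourier 1 η) * Θ) ^ k := by
    intro N
    rw [integral_const_mul, integral_finsetSum]
    · congr 1
      refine Finset.sum_congr rfl fun k _ => ?_
      simp only [hy, mul_pow, ← fourier_pow]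
      rw [integral_const_mul, hk]
    · intro k _
      exact (hyc.pow k).integrable_of_hasCompactSupport (HasCompactSupport.of_compactSpace _)
  simp_rw [h2] at h1
  have h3 := cesaro (conj (fourier 1 η) * Θ) (by
    rw [norm_mul, RCLike.norm_conj, norm_f, one_mul]; exact hΘ)
  have h4 := tendsto_nhds_unique h1 h3
  rw [if_neg] at h4
  · have h5 : (fun x => if y x = 1 then (1:ℂ) else 0) = Set.indicator {η} (fun _ => 1) := by
      ext x
      have : y x = 1 ↔ x ∈ ({η} : Set TT) := by
        rw [Set.mem_singleton_iff]
        constructor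
        · intro h
          apply fourier_one_inj
          have : fourier 1 η * (conj (fourier 1 η) * fourier 1 x) = fourier 1 η * 1 := by
            rw [← h]
          rw [← mul_assoc, mul_comm (fourier 1 η), hηη] at this
          simpa using this
        · rintro rfl; exact hηη
      simp only [this, Set.indicator]
    rw [h5, integral_indicator (measurableSet_singleton _)] at h4
    simp only [integral_const, MeasurableSet.univ, measureReal_restrict_apply, Set.univ_inter] at h4
    simpa [Measure.real, ENNReal.toReal_eq_zero_iff] using h4
  · intro h
    apply hη
    have : fourier 1 η * (conj (fourier 1 η) * Θ) = fourier 1 η * 1 := by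
      rw [← h]
    rw [← mul_assoc, mul_comm (fourier 1 η), hηη] at this
    simpa using this.symm

lemma affine_closed (κ : Measure TT) [IsProbabilityMeasure κ] (w : TT → ℂ) (hw : MemLp w 2 κ)
    (a b : ℕ → ℂ)
    (h : Tendsto (fun j => eLpNorm (fun β => w β - (a j + b j * fourier 1 β)) 2 κ) atTop (𝓝 0)) :
    ∃ a b : ℂ, ∀ᵐ x ∂κ, w x = a + b * fourier 1 x := by
  have m1 : MemLp (fun _ : TT => (1:ℂ)) 2 κ := memLp_const _
  have m2 : MemLp (fun x : TT => fourier 1 x) 2 κ :=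
    MemLp.of_bound (fourier 1).continuous.aestronglyMeasurable 1 (ae_of_all _ fun x => (norm_f 1 x).le)
  let S : Submodule ℂ (Lp ℂ 2 κ) := Submodule.span ℂ {m1.toLp _, m2.toLp _}
  have : FiniteDimensional ℂ S := FiniteDimensional.span_of_finite ℂ (by simp)
  have hS : IsClosed (S : Set (Lp ℂ 2 κ)) := S.closed_of_finiteDimensional
  have hmem : hw.toLp _ ∈ S := by
    refine hS.mem_of_tendsto (b := atTop) (f := fun j => a j • m1.toLp _ + b j • m2.toLp _) ?_
      (Eventually.of_forall fun j => Submodule.add_mem _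
        (Submodule.smul_mem _ _ (Submodule.subset_span (by simp)))
        (Submodule.smul_mem _ _ (Submodule.subset_span (by simp))))
    rw [tendsto_iff_edist_tendsto_0]
    refine h.congr fun j => ?_
    rw [edist_comm, Lp.edist_def]
    apply eLpNorm_congr_ae
    filter_upwards [hw.coeFn_toLp, m1.coeFn_toLp, m2.coeFn_toLp,
      Lp.coeFn_add (a j • m1.toLp _) (b j • m2.toLp _), Lp.coeFn_smul (a j) (m1.toLp _),
      Lp.coeFn_smul (b j) (m2.toLp _)] with x e1 e2 e3 e4 e5 e6
    simp only [Pi.sub_apply, e1, e4, Pi.add_apply, e5, e6, Pi.smul_apply, e2, e3, smul_eq_mul, mul_one]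
  obtain ⟨a, b, hab⟩ := Submodule.mem_span_pair.1 hmem
  refine ⟨a, b, ?_⟩
  filter_upwards [hw.coeFn_toLp, m1.coeFn_toLp, m2.coeFn_toLp,
      Lp.coeFn_add (a • m1.toLp _) (b • m2.toLp _), Lp.coeFn_smul a (m1.toLp _),
      Lp.coeFn_smul b (m2.toLp _)] with x e1 e2 e3 e4 e5 e6
  rw [← e1, ← hab]
  simp only [e4, Pi.add_apply, e5, e6, Pi.smul_apply, e2, e3, smul_eq_mul, mul_one]

lemma fibre_nonzero (κ : Measure TT) [IsProbabilityMeasure κ] (Θ : ℂ)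
    (hk : ∀ k : ℕ, ∫ x, fourier (k:ℤ) x ∂κ = Θ ^ k) (w : TT → ℂ) (hw : MemLp w 2 κ)
    (a b : ℕ → ℂ)
    (h : Tendsto (fun j => eLpNorm (fun β => w β - (a j + b j * fourier 1 β)) 2 κ) atTop (𝓝 0))
    (h0 : ∫ x, w x ∂κ ≠ 0) : ∀ᵐ x ∂κ, w x ≠ 0 := by
  obtain ⟨a, b, hab⟩ := affine_closed κ w hw a b h
  have hi : Integrable (fun x : TT => fourier 1 x) κ :=
    (fourier 1).continuous.integrable_of_hasCompactSupport (HasCompactSupport.of_compactSpace _)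
  have h1 : a + b * Θ ≠ 0 := by
    rw [integral_congr_ae hab, integral_add (integrable_const _) (hi.const_mul _),
      integral_const_mul] at h0
    have := hk 1
    rw [pow_one, Nat.cast_one] at this
    rw [this] at h0
    simpa using h0
  by_cases hb : b = 0
  · filter_upwards [hab] with x hx
    rw [hx]; subst hb; simpa using h1
  by_cases hη : ∃ η : TT, a + b * fourier 1 η = 0
  · obtain ⟨η, hη⟩ := hη
    have : κ {η} = 0 := by
      apply wiener_atom κ Θ hk
      intro h; rw [h] at hη; exact h1 hη
    have h2 : ∀ᵐ x ∂κ, x ≠ η := by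
      rw [ae_iff]; simpa using this
    filter_upwards [hab, h2] with x hx h2 hw0
    rw [hx] at hw0
    apply h2
    apply fourier_one_inj
    have : b * fourier 1 x = b * fourier 1 η := by
      linear_combination hw0 - hη
    exact mul_left_cancel₀ hb this
  · push Not at hη
    filter_upwards [hab] with x hx
    rw [hx]; exact hη x

end CyclicAux

open MeasureTheory

namespace CyclicAux
open AddCircle Filter Topology ComplexConjugate ProbabilityTheory

lemma integrable_cont {X : Type*} [TopologicalSpace X] [CompactSpace X] [MeasurableSpace X] [BorelSpace X]
    [SecondCountableTopology X] (m : Measure X) [IsFiniteMeasure m] {g : X → ℂ} (hg : Continuous g) :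
    Integrable g m :=
  hg.integrable_of_hasCompactSupport (HasCompactSupport.of_compactSpace _)

lemma measure_eq_hh (ν : Measure TT) [IsProbabilityMeasure ν]
    (h : ∀ n : ℤ, n ≠ 0 → ∫ x, fourier n x ∂ν = 0) : ν = hh := by
  let I (m : Measure TT) [IsProbabilityMeasure m] : C(TT, ℂ) →L[ℂ] ℂ :=
    LinearMap.mkContinuous
      { toFun := fun g => ∫ x, g x ∂m
        map_add' := fun a b => integral_add (integrable_cont m a.continuous) (integrable_cont m b.continuous)
        map_smul' := fun a b => integral_const_mul a _ } 1 (fun g => by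
          rw [one_mul]
          refine (norm_integral_le_of_norm_le_const (ae_of_all _ fun x => g.norm_coe_le_norm x)).trans ?_
          simp)
  have hI : I ν = I hh := by
    have h1 : (⊤ : Submodule ℂ C(TT, ℂ)) ≤ (I ν - I hh).ker := by
      rw [← span_fourier_closure_eq_top (T := 1)]
      apply Submodule.topologicalClosure_minimal _ _ (ContinuousLinearMap.isClosed_ker _)
      rw [Submodule.span_le]
      rintro _ ⟨n, rfl⟩
      have : ∫ x, fourier n x ∂ν - ∫ x, fourier n x ∂hh = 0 := by
        rw [int_fourier]
        by_cases hn : n = 0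
        · subst hn; simp
        · rw [h n hn, if_neg hn, sub_zero]
      exact this
    ext g
    have := h1 (Submodule.mem_top (x := g))
    exact sub_eq_zero.1 this
  apply ext_of_forall_integral_eq_of_IsFiniteMeasure
  intro f
  have := congrArg (fun L => L (⟨fun x => (f x : ℂ), by fun_prop⟩ : C(TT, ℂ))) hI
  have h2 : ∫ x, (f x : ℂ) ∂ν = ∫ x, (f x : ℂ) ∂hh := this
  rw [integral_complex_ofReal, integral_complex_ofReal] at h2
  exact_mod_cast h2

lemma theta_mul (κ : Kernel TT TT) [IsMarkovKernel κ] (c : ℤ × ℤ → ℂ)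
    (hc : ∀ r, ∫ z, ee r z ∂(hh ⊗ₘ κ) = c r)
    (M0 : ∀ n : ℤ, n ≠ 0 → c (n, 0) = 0)
    (M1 : ∀ (k : ℕ) (n : ℤ), c (n, (k:ℤ)+1) = ∑ j ∈ Finset.Icc 1 n, c (j, 1) * c (n - j, k)) :
    ∀ᵐ x ∂hh, ∀ k : ℕ, ∫ y, fourier (k:ℤ) y ∂(κ x) = (∫ y, fourier 1 y ∂(κ x)) ^ k := by
  set Θ : ℤ → TT → ℂ := fun k x => ∫ y, fourier k y ∂(κ x) with hΘ
  have hΘm : ∀ k, StronglyMeasurable (Θ k) := fun k =>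
    (fourier k).continuous.stronglyMeasurable.integral_kernel
  have hΘb : ∀ k x, ‖Θ k x‖ ≤ 1 := fun k x => by
    refine (norm_integral_le_of_norm_le_const (ae_of_all _ fun y => (norm_f k y).le)).trans ?_
    simp
  have hΘL : ∀ k, MemLp (Θ k) 2 hh := fun k =>
    MemLp.of_bound (hΘm k).aestronglyMeasurable 1 (ae_of_all _ (hΘb k))
  have hcoef : ∀ n k, ∫ x, fourier n x * Θ k x ∂hh = c (n, k) := by
    intro n k
    rw [← hc, Measure.integral_compProd (integrable_cont _ (ee _).continuous)]
    simp only [ee_apply, integral_const_mul, hΘ]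
  have c1 : ∀ i : ℤ, i ≤ 0 → ∀ k : ℕ, c (i, (k:ℤ)+1) = 0 := by
    intro i hi k
    rw [M1, Finset.Icc_eq_empty (by omega), Finset.sum_empty]
  have step : ∀ k : ℕ, ∀ᵐ x ∂hh, Θ ((k:ℤ)+1) x - Θ 1 x * Θ k x = 0 := by
    intro k
    have hprod : Integrable (fun x => Θ 1 x * Θ k x) hh :=
      Integrable.of_bound ((hΘm 1).mul (hΘm k)).aestronglyMeasurable 1 (ae_of_all _ fun x => by
        rw [norm_mul]; exact mul_le_one₀ (hΘb 1 x) (norm_nonneg _) (hΘb k x))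
    have hint : Integrable (Θ ((k:ℤ)+1)) hh := (hΘL _).integrable (by norm_num)
    refine ae_zero_of_dense hh (fun x => Θ ((k:ℤ)+1) x - Θ 1 x * Θ k x) (hint.sub hprod)
      (Set.range fourier) span_fourier_closure_eq_top ?_
    rintro _ ⟨n, rfl⟩
    have hfm : ∀ {u : TT → ℂ}, Integrable u hh → Integrable (fun x => fourier n x * u x) hh := fun hu =>
      hu.bdd_mul (c := 1) (fourier n).continuous.aestronglyMeasurable (ae_of_all _ fun x => (norm_f n x).le)
    simp_rw [mul_sub]
    rw [integral_sub (hfm hint) (hfm hprod), hcoef, M1, sub_eq_zero]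
    have mA : MemLp (fun x => conj (Θ 1 x)) 2 hh :=
      MemLp.of_bound (Complex.continuous_conj.comp_stronglyMeasurable (hΘm 1)).aestronglyMeasurable 1
        (ae_of_all _ fun x => by rw [RCLike.norm_conj]; exact hΘb 1 x)
    have mB : MemLp (fun x => fourier n x * Θ k x) 2 hh := memLp_mulC hh (fourier n) (hΘL k)
    have hs := (fourierBasis (T := 1)).hasSum_inner_mul_inner (mA.toLp _) (mB.toLp _)
    have e1 : inner ℂ (mA.toLp _) (mB.toLp _) = ∫ x, fourier n x * (Θ 1 x * Θ k x) ∂hh := by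
      rw [inner_Lp]
      apply integral_congr_ae
      filter_upwards [mA.coeFn_toLp, mB.coeFn_toLp] with x a b
      rw [a, b, Complex.conj_conj]; ring
    have e2 : ∀ i : ℤ, inner ℂ (mA.toLp _) (fourierBasis (T := 1) i) * inner ℂ (fourierBasis (T := 1) i) (mB.toLp _)
        = c (i, 1) * c (n - i, k) := by
      intro i
      rw [coe_fourierBasis, inner_Lp, inner_Lp, ← hcoef, ← hcoef]
      congr 1
      · apply integral_congr_ae
        filter_upwards [mA.coeFn_toLp, coeFn_fourierLp (T := 1) 2 i] with x a b
        rw [a, b, Complex.conj_conj]; ring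
      · apply integral_congr_ae
        filter_upwards [mB.coeFn_toLp, coeFn_fourierLp (T := 1) 2 i] with x a b
        rw [a, b, sub_eq_add_neg, fourier_add, fourier_neg]; ring
    rw [e1] at hs
    simp_rw [e2] at hs
    have h0 : ∀ i ∉ Finset.Icc 1 n, c (i, 1) * c (n - i, k) = 0 := by
      intro i hi
      rw [Finset.mem_Icc, not_and_or] at hi
      rcases hi with hi | hi
      · have := c1 i (by omega) 0
        simp only [Nat.cast_zero, zero_add] at this
        rw [this, zero_mul]
      · cases k with
        | zero =>
          have := M0 (n - i) (by omega)
          simp only [Nat.cast_zero]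
          rw [this, mul_zero]
        | succ k =>
          have := c1 (n - i) (by omega) k
          push_cast
          rw [this, mul_zero]
    exact (hasSum_sum_of_ne_finset_zero h0).unique hs
  filter_upwards [ae_all_iff.2 step] with x hx k
  induction k with
  | zero => simp
  | succ k ih =>
    have := hx k
    rw [sub_eq_zero] at this
    change Θ ((k+1 : ℕ) : ℤ) x = _
    push_cast
    rw [this, pow_succ']
    congr 1

end CyclicAux

open MeasureTheory

namespace CyclicAux
open AddCircle Filter Topology ComplexConjugate ProbabilityTheory

lemma eLpNorm_two_sq {X E : Type*} [MeasurableSpace X] [NormedAddCommGroup E] (m : Measure X) (f : X → E) :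
    eLpNorm f 2 m ^ 2 = ∫⁻ x, ‖f x‖ₑ ^ 2 ∂m := by
  rw [eLpNorm_eq_lintegral_rpow_enorm_toReal (by norm_num) (by norm_num)]
  simp only [ENNReal.toReal_ofNat, ENNReal.rpow_ofNat, one_div]
  rw [← ENNReal.rpow_natCast, ← ENNReal.rpow_mul]
  norm_num

lemma combined (κ : Kernel TT TT) [IsMarkovKernel κ]
    (hmult : ∀ᵐ x ∂hh, ∀ k : ℕ, ∫ y, fourier (k:ℤ) y ∂(κ x) = (∫ y, fourier 1 y ∂(κ x)) ^ k)
    (w : TT × TT → ℂ) (hws : StronglyMeasurable w) (hw : MemLp w 2 (hh ⊗ₘ κ))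
    (hlim : ∀ ε : ENNReal, 0 < ε → ∃ p q : C(TT, ℂ),
      eLpNorm (fun z => w z - (p z.1 + q z.1 * fourier 1 z.2)) 2 (hh ⊗ₘ κ) ^ 2 ≤ ε)
    (h1 : ∀ n : ℕ, ∫ z, ee (-((n:ℤ)+1), 0) z * w z ∂(hh ⊗ₘ κ) = 0)
    (h2 : ∃ n : ℤ, ∫ z, ee (n, 0) z * w z ∂(hh ⊗ₘ κ) ≠ 0) : ∀ᵐ z ∂(hh ⊗ₘ κ), w z ≠ 0 := by
  have hsec : ∀ x, StronglyMeasurable (fun y => w (x, y)) := fun x =>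
    hws.comp_measurable measurable_prodMk_left
  have hsq : ∫⁻ x, ∫⁻ y, ‖w (x, y)‖ₑ ^ 2 ∂(κ x) ∂hh < ⊤ := by
    rw [← Measure.lintegral_compProd (hws.measurable.enorm.pow_const 2), ← eLpNorm_two_sq]
    exact ENNReal.pow_lt_top hw.2
  have hsqm : Measurable fun x => ∫⁻ y, ‖w (x, y)‖ₑ ^ 2 ∂(κ x) :=
    Measurable.lintegral_kernel_prod_right' (hws.measurable.enorm.pow_const 2)
  have hfib : ∀ᵐ x ∂hh, MemLp (fun y => w (x, y)) 2 (κ x) := by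
    filter_upwards [ae_lt_top hsqm hsq.ne] with x hx
    refine ⟨(hsec x).aestronglyMeasurable, ?_⟩
    rw [← eLpNorm_two_sq] at hx
    by_contra h
    rw [not_lt, top_le_iff] at h
    rw [h] at hx
    simp at hx
  set G : TT → ℂ := fun x => ∫ y, w (x, y) ∂(κ x) with hGdef
  have hGm : StronglyMeasurable G := hws.integral_kernel_prod_right'
  have hGL : MemLp G 2 hh := by
    refine ⟨hGm.aestronglyMeasurable, ?_⟩
    have : eLpNorm G 2 hh ^ 2 < ⊤ := by
      rw [eLpNorm_two_sq]
      refine lt_of_le_of_lt (lintegral_mono fun x => ?_) hsq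
      rw [← eLpNorm_two_sq]
      gcongr
      refine (enorm_integral_le_lintegral_enorm _).trans ?_
      rw [← eLpNorm_one_eq_lintegral_enorm]
      exact eLpNorm_le_eLpNorm_of_exponent_le (by norm_num) (hsec x).aestronglyMeasurable
    by_contra h
    rw [not_lt, top_le_iff] at h
    rw [h] at this
    simp at this
  have hcoef : ∀ n : ℤ, ∫ z, ee (n, 0) z * w z ∂(hh ⊗ₘ κ) = ∫ x, fourier n x * G x ∂hh := by
    intro n
    have hi : Integrable (fun z => ee (n, 0) z * w z) (hh ⊗ₘ κ) :=
      (memLp_mulC _ (ee (n, 0)) hw).integrable (by norm_num)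
    rw [Measure.integral_compProd hi]
    congr 1
    ext x
    simp only [ee_apply, fourier_zero, mul_one, hGdef]
    rw [integral_const_mul]
  have hG0 : ∀ᵐ x ∂hh, G x ≠ 0 := by
    apply riesz_unique G hGL
    · intro n; rw [← hcoef]; exact h1 n
    · obtain ⟨n, hn⟩ := h2
      exact ⟨n, by rw [← hcoef]; exact hn⟩
  choose p q hpq using fun i : ℕ => hlim ((2:ENNReal)⁻¹ ^ i) (ENNReal.pow_pos (by norm_num) i)
  have hdm : ∀ i, StronglyMeasurable (fun z : TT × TT => w z - (p i z.1 + q i z.1 * fourier 1 z.2)) := by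
    intro i
    refine hws.sub (Continuous.stronglyMeasurable ?_)
    fun_prop
  have hFm : ∀ i, Measurable (fun x => ∫⁻ y, ‖w (x, y) - (p i x + q i x * fourier 1 y)‖ₑ ^ 2 ∂(κ x)) := fun i =>
    Measurable.lintegral_kernel_prod_right' ((hdm i).measurable.enorm.pow_const 2)
  have hF : ∀ᵐ x ∂hh, ∑' i, ∫⁻ y, ‖w (x, y) - (p i x + q i x * fourier 1 y)‖ₑ ^ 2 ∂(κ x) < ⊤ := by
    apply ae_lt_top (Measurable.tsum hFm)
    rw [lintegral_tsum (fun i => (hFm i).aemeasurable)]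
    have : ∑' i : ℕ, (2:ENNReal)⁻¹ ^ i ≠ ⊤ := by
      rw [ENNReal.tsum_geometric]; simp
    refine ne_top_of_le_ne_top this (ENNReal.tsum_le_tsum fun i => ?_)
    rw [← Measure.lintegral_compProd (f := fun z : TT × TT => ‖w z - (p i z.1 + q i z.1 * fourier 1 z.2)‖ₑ ^ 2)
      ((hdm i).measurable.enorm.pow_const 2), ← eLpNorm_two_sq]
    exact hpq i
  apply Measure.ae_compProd_of_ae_ae
  · exact (hws.measurable (measurableSet_singleton 0)).compl
  filter_upwards [hmult, hfib, hG0, hF] with x a1 a2 a3 a4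
  refine fibre_nonzero (κ x) _ a1 (fun y => w (x, y)) a2 (fun i => p i x) (fun i => q i x) ?_ a3
  have := ENNReal.tendsto_atTop_zero_of_tsum_ne_top a4.ne
  simp_rw [← eLpNorm_two_sq] at this
  have h3 := (ENNReal.continuous_rpow_const (y := 1/2)).tendsto 0 |>.comp this
  simp only [one_div] at h3
  rw [ENNReal.zero_rpow_of_pos (by norm_num)] at h3
  refine h3.congr fun i => ?_
  simp only [Function.comp]
  rw [← ENNReal.rpow_natCast, ← ENNReal.rpow_mul]
  norm_num

/-- The main measure-theoretic statement. -/
theorem measure_main (m : Measure (TT × TT)) [IsProbabilityMeasure m] (c : ℤ × ℤ → ℂ)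
    (hc : ∀ r, ∫ z, ee r z ∂m = c r)
    (M0 : ∀ n : ℤ, n ≠ 0 → c (n, 0) = 0)
    (M1 : ∀ (k : ℕ) (n : ℤ), c (n, (k:ℤ)+1) = ∑ j ∈ Finset.Icc 1 n, c (j, 1) * c (n - j, k))
    (one : Lp ℂ 2 m) (hone : one =ᵐ[m] fun _ => 1)
    (w : Lp ℂ 2 m)
    (hw : w ∈ (Submodule.span ℂ {v : Lp ℂ 2 m | ∃ (n k : ℤ), (k = 0 ∨ k = 1) ∧
      v = mulC m (ee (n, k)) one}).topologicalClosure)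
    (h1 : ∀ n : ℕ, ∫ z, ee (-((n:ℤ)+1), 0) z * w z ∂m = 0)
    (h2 : ∃ n : ℤ, ∫ z, ee (n, 0) z * w z ∂m ≠ 0) (ε : ℝ) (hε : 0 < ε) :
    ∃ l : (ℤ × ℤ) →₀ ℂ, ‖one - l.sum fun r a => a • mulC m (ee r) w‖ < ε := by
  have hfst : m.fst = hh := by
    apply measure_eq_hh
    intro n hn
    rw [Measure.fst, integral_map measurable_fst.aemeasurable (fourier n).continuous.aestronglyMeasurable]
    rw [← M0 n hn, ← hc]
    simp [ee_apply]
  have hdis : hh ⊗ₘ m.condKernel = m := by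
    rw [← hfst]; exact m.disintegrate _
  have hw0 : ∀ᵐ z ∂m, w z ≠ 0 := by
    have hc' := hc
    have h1' := h1
    have h2' := h2
    have hwl := Lp.memLp w
    have hlim : ∀ ε : ENNReal, 0 < ε → ∃ p q : C(TT, ℂ),
        eLpNorm (fun z => w z - (p z.1 + q z.1 * fourier 1 z.2)) 2 m ^ 2 ≤ ε := by
      intro ε hε
      obtain ⟨δ, hδ, hδε⟩ : ∃ δ : ENNReal, 0 < δ ∧ δ ^ 2 ≤ ε := by
        refine ⟨min 1 ε, by simp [hε], ?_⟩
        rw [pow_two]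
        calc min 1 ε * min 1 ε ≤ 1 * ε := mul_le_mul' (min_le_left _ _) (min_le_right _ _)
          _ = ε := one_mul _
      have hcl : w ∈ closure ((Submodule.span ℂ {v : Lp ℂ 2 m | ∃ (n k : ℤ), (k = 0 ∨ k = 1) ∧
          v = mulC m (ee (n, k)) one} : Submodule ℂ (Lp ℂ 2 m)) : Set (Lp ℂ 2 m)) := hw
      obtain ⟨s, hs, hd⟩ := EMetric.mem_closure_iff.1 hcl δ hδ
      have hsp : ∃ p q : C(TT, ℂ), s =ᵐ[m] fun z => p z.1 + q z.1 * fourier 1 z.2 := by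
        clear hd
        refine Submodule.span_induction ?_ ?_ ?_ ?_ hs
        · rintro v ⟨n, k, hk, rfl⟩
          rcases hk with rfl | rfl
          · refine ⟨fourier n, 0, ?_⟩
            filter_upwards [mulC_coe m (ee (n, 0)) one, hone] with z a b
            rw [a, b]; simp [ee_apply]
          · refine ⟨0, fourier n, ?_⟩
            filter_upwards [mulC_coe m (ee (n, 1)) one, hone] with z a b
            rw [a, b, ee_apply]; simp
        · refine ⟨0, 0, ?_⟩
          filter_upwards [Lp.coeFn_zero ℂ 2 m] with z a
          rw [a]; simp
        · rintro x y _ _ ⟨p, q, h⟩ ⟨p', q', h'⟩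
          refine ⟨p + p', q + q', ?_⟩
          filter_upwards [Lp.coeFn_add x y, h, h'] with z a b c
          rw [a, Pi.add_apply, b, c]
          simp only [ContinuousMap.add_apply]; ring
        · rintro a x _ ⟨p, q, h⟩
          refine ⟨a • p, a • q, ?_⟩
          filter_upwards [Lp.coeFn_smul a x, h] with z b c
          rw [b, Pi.smul_apply, c]
          simp only [ContinuousMap.smul_apply, smul_eq_mul]; ring
      obtain ⟨p, q, hpq⟩ := hsp
      refine ⟨p, q, le_trans ?_ hδε⟩
      gcongr
      refine le_trans (le_of_eq ?_) hd.le
      rw [Lp.edist_def]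
      apply eLpNorm_congr_ae
      filter_upwards [hpq] with z a
      rw [Pi.sub_apply, a]
    have hws := Lp.stronglyMeasurable w
    generalize (w : TT × TT → ℂ) = u at *
    rw [← hdis] at hc' h1' h2' hwl hlim ⊢
    exact combined _ (theta_mul _ c hc' M0 M1) u hws hwl hlim h1' h2'
  have htop : (Submodule.span ℂ (Set.range fun r => mulC m (ee r) w)).topologicalClosure = ⊤ := by
    rw [Submodule.topologicalClosure_eq_top_iff, Submodule.eq_bot_iff]
    intro y hy
    have hi : Integrable (fun z => conj (w z) * y z) m := by
      have h := L2.integrable_inner (𝕜 := ℂ) w y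
      refine h.congr (ae_of_all _ fun x => ?_)
      simp only [RCLike.inner_apply]
      ring
    have hz := ae_zero_of_dense m (fun z => conj (w z) * y z) hi (Set.range ee) span_ee_dense (by
      rintro _ ⟨r, rfl⟩
      have := (Submodule.mem_orthogonal _ _).1 hy _ (Submodule.subset_span ⟨-r, rfl⟩)
      rw [inner_Lp] at this
      rw [← this]
      apply integral_congr_ae
      filter_upwards [mulC_coe m (ee (-r)) w] with z a
      rw [a, ee_neg, map_mul]
      simp only [ContinuousMap.star_apply, RCLike.star_def, Complex.conj_conj]; ring)
    apply Lp.ext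
    filter_upwards [hz, hw0, Lp.coeFn_zero ℂ 2 m] with z a b c
    rw [c]
    simpa [b] using a
  have hmem : one ∈ (Submodule.span ℂ (Set.range fun r => mulC m (ee r) w)).topologicalClosure := by
    rw [htop]; exact Submodule.mem_top
  have hcl : one ∈ closure ((Submodule.span ℂ (Set.range fun r => mulC m (ee r) w) :
    Submodule ℂ (Lp ℂ 2 m)) : Set (Lp ℂ 2 m)) := hmem
  obtain ⟨s, hs, hd⟩ := Metric.mem_closure_iff.1 hcl ε hε
  obtain ⟨l, rfl⟩ := Finsupp.mem_span_range_iff_exists_finsupp.1 hs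
  exact ⟨l, by rwa [dist_eq_norm] at hd⟩

end CyclicAux

open MeasureTheory

namespace CyclicAux
open AddCircle Filter Topology ComplexConjugate

section op
variable {K : Type*} [NormedAddCommGroup K] [InnerProductSpace ℂ K]

/-- `1 + (z-1) b b*` -/
noncomputable def rotL (b : K) (z : ℂ) : K →ₗ[ℂ] K :=
  LinearMap.id + (z - 1) • ((innerSL ℂ b).toLinearMap.smulRight b)

lemma rotL_apply (b : K) (z : ℂ) (g : K) : rotL b z g = g + ((z - 1) * inner ℂ b g) • b := by
  simp [rotL, smul_smul]

lemma inner_rotL {b : K} (hb : ‖b‖ = 1) (z : ℂ) (g : K) :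
    inner ℂ b (rotL b z g) = z * inner ℂ b g := by
  rw [rotL_apply, inner_add_right, inner_smul_right, inner_self_eq_norm_sq_to_K, hb]
  norm_num
  ring

lemma rotL_rotL {b : K} (hb : ‖b‖ = 1) (z z' : ℂ) (h : z * z' = 1) (g : K) :
    rotL b z (rotL b z' g) = g := by
  rw [rotL_apply, inner_rotL hb, rotL_apply, add_assoc, ← add_smul]
  have : (z' - 1) * inner ℂ b g + (z - 1) * (z' * inner ℂ b g) = 0 := by
    linear_combination (inner ℂ b g) * h
  rw [this, zero_smul, add_zero]

lemma norm_rotL {b : K} (hb : ‖b‖ = 1) (z : ℂ) (hz : ‖z‖ = 1) (g : K) : ‖rotL b z g‖ = ‖g‖ := by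
  have key : ∀ z : ℂ, ‖z‖ = 1 → ‖rotL b z g‖ ^ 2 = ‖g - (inner ℂ b g : ℂ) • b‖ ^ 2 + ‖(inner ℂ b g : ℂ) • b‖ ^ 2 := by
    intro z hz
    have h1 : rotL b z g = (g - (inner ℂ b g : ℂ) • b) + (z * inner ℂ b g) • b := by
      rw [rotL_apply, sub_mul, sub_smul, one_mul]; abel
    have h2 : inner ℂ (g - (inner ℂ b g : ℂ) • b) ((z * inner ℂ b g) • b) = 0 := by
      rw [inner_smul_right, inner_sub_left, inner_smul_left, inner_self_eq_norm_sq_to_K, hb, inner_conj_symm]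
      norm_num
    rw [h1, norm_add_sq (𝕜 := ℂ), h2]
    simp [norm_smul, hz]
  have h1 := key z hz
  have h2 := key 1 norm_one
  have h3 : rotL b 1 g = g := by rw [rotL_apply]; simp
  rw [h3] at h2
  rw [← h2] at h1
  exact (pow_left_inj₀ (norm_nonneg _) (norm_nonneg _) two_ne_zero).1 h1

lemma fneg_mul (x : TT) (n : ℤ) : fourier n x * fourier (-n) x = (1:ℂ) := by
  rw [← fourier_add]; simp

lemma fneg_mul' (x : TT) (n : ℤ) : fourier (-n) x * fourier n x = (1:ℂ) := by
  rw [← fourier_add]; simp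

/-- The rank one rotation as a unitary. -/
noncomputable def rot (b : K) (hb : ‖b‖ = 1) (x : TT) : K ≃ₗᵢ[ℂ] K where
  toLinearEquiv := LinearEquiv.ofLinearMap (rotL b (fourier 1 x)) (rotL b (fourier (-1) x))
    (LinearMap.ext fun g => rotL_rotL hb _ _ (fneg_mul x 1) g)
    (LinearMap.ext fun g => rotL_rotL hb _ _ (fneg_mul' x 1) g)
  norm_map' := fun g => norm_rotL hb _ (norm_f 1 x) g

lemma rot_apply (b : K) (hb : ‖b‖ = 1) (x : TT) (g : K) :
    rot b hb x g = g + ((fourier 1 x - 1) * inner ℂ b g) • b := rotL_apply _ _ _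

lemma rot_symm_apply (b : K) (hb : ‖b‖ = 1) (x : TT) (g : K) :
    (rot b hb x).symm g = g + ((fourier (-1) x - 1) * inner ℂ b g) • b := rotL_apply _ _ _

/-- The perturbed unitary. -/
noncomputable def Ua (U : K ≃ₗᵢ[ℂ] K) (b : K) (hb : ‖b‖ = 1) (x : TT) : K ≃ₗᵢ[ℂ] K := U * rot b hb x

lemma Ua_apply (U : K ≃ₗᵢ[ℂ] K) (b : K) (hb : ‖b‖ = 1) (x : TT) (g : K) :
    Ua U b hb x g = U g + ((fourier 1 x - 1) * inner ℂ b g) • U b := by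
  change U (rot b hb x g) = _
  rw [rot_apply, map_add, map_smul]

lemma Ua_inv_apply (U : K ≃ₗᵢ[ℂ] K) (b : K) (hb : ‖b‖ = 1) (x : TT) (g : K) :
    (Ua U b hb x)⁻¹ g = U⁻¹ g + ((fourier (-1) x - 1) * inner ℂ b (U⁻¹ g)) • b := by
  rw [Ua, mul_inv_rev]
  change (rot b hb x).symm (U⁻¹ g) = _
  rw [rot_symm_apply]

lemma Ua_b (U : K ≃ₗᵢ[ℂ] K) (b : K) (hb : ‖b‖ = 1) (x : TT) :
    Ua U b hb x b = (fourier 1 x : ℂ) • U b := by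
  rw [Ua_apply, inner_self_eq_norm_sq_to_K, hb, sub_mul, sub_smul]; norm_num

lemma Ua_zpow_cont (U : K ≃ₗᵢ[ℂ] K) (b : K) (hb : ‖b‖ = 1) (n : ℤ) :
    Continuous fun p : TT × K => (Ua U b hb p.1 ^ n) p.2 := by
  have h1 : Continuous fun p : TT × K => (p.1, Ua U b hb p.1 p.2) := by
    simp_rw [Ua_apply]
    have := U.continuous
    fun_prop
  have h2 : Continuous fun p : TT × K => (p.1, (Ua U b hb p.1)⁻¹ p.2) := by
    simp_rw [Ua_inv_apply]
    have := U⁻¹.continuous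
    fun_prop
  have h3 : ∀ n : ℕ, Continuous fun p : TT × K => (Ua U b hb p.1 ^ n) p.2 := by
    intro n
    induction n with
    | zero => simpa using continuous_snd
    | succ n ih => exact (ih.comp h1).congr fun p => by simp [pow_succ]
  have h4 : ∀ n : ℕ, Continuous fun p : TT × K => ((Ua U b hb p.1)⁻¹ ^ n) p.2 := by
    intro n
    induction n with
    | zero => simpa using continuous_snd
    | succ n ih => exact (ih.comp h2).congr fun p => by simp only [pow_succ]; rfl
  cases n with
  | ofNat n => exact (h3 n).congr fun p => by simp
  | negSucc n => exact (h4 (n+1)).congr fun p => by rw [zpow_negSucc, inv_pow]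

variable (U : K ≃ₗᵢ[ℂ] K) (b : K) (hb : ‖b‖ = 1)

lemma norm_Ef (r : ℤ × ℤ) (x : TT) (g : K) :
    ‖(fourier (-r.2) x : ℂ) • (Ua U b hb x ^ r.1) g‖ = ‖g‖ := by
  rw [norm_smul, norm_f, one_mul, LinearIsometryEquiv.norm_map]

lemma memLp_E (r : ℤ × ℤ) {f : TT → K} (hf : MemLp f 2 hh) :
    MemLp (fun x => (fourier (-r.2) x : ℂ) • (Ua U b hb x ^ r.1) (f x)) 2 hh := by
  refine hf.of_le (?_) (ae_of_all _ fun x => (norm_Ef U b hb r x (f x)).le)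
  have hc : Continuous fun p : TT × K => (fourier (-r.2) p.1 : ℂ) • (Ua U b hb p.1 ^ r.1) p.2 :=
    ((fourier (-r.2)).continuous.comp continuous_fst).smul (Ua_zpow_cont U b hb r.1)
  have hid : AEStronglyMeasurable (fun x : TT => x) hh := aestronglyMeasurable_id
  exact hc.comp_aestronglyMeasurable (hid.prodMk hf.1)

/-- The operators `ᾱ^k U_α^n` on `L²(𝕋; K)`. -/
noncomputable def EE (r : ℤ × ℤ) : Lp K 2 hh →L[ℂ] Lp K 2 hh :=
  LinearMap.mkContinuous
    { toFun := fun f => (memLp_E U b hb r (Lp.memLp f)).toLp _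
      map_add' := fun a c => by
        apply Lp.ext
        filter_upwards [(memLp_E U b hb r (Lp.memLp (a+c))).coeFn_toLp,
          (memLp_E U b hb r (Lp.memLp a)).coeFn_toLp, (memLp_E U b hb r (Lp.memLp c)).coeFn_toLp,
          Lp.coeFn_add a c, Lp.coeFn_add ((memLp_E U b hb r (Lp.memLp a)).toLp _)
            ((memLp_E U b hb r (Lp.memLp c)).toLp _)] with x h1 h2 h3 h4 h5
        rw [h1, h5, Pi.add_apply, h2, h3, h4, Pi.add_apply, map_add, smul_add]
      map_smul' := fun c a => by
        apply Lp.ext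
        filter_upwards [(memLp_E U b hb r (Lp.memLp (c • a))).coeFn_toLp,
          (memLp_E U b hb r (Lp.memLp a)).coeFn_toLp,
          Lp.coeFn_smul c a, Lp.coeFn_smul c ((memLp_E U b hb r (Lp.memLp a)).toLp _)] with x h1 h2 h4 h5
        rw [h1, RingHom.id_apply, h5, Pi.smul_apply, h2, h4, Pi.smul_apply, map_smul, smul_comm] }
    1 (fun f => by
      apply Lp.norm_le_mul_norm_of_ae_le_mul
      simp only [LinearMap.coe_mk, AddHom.coe_mk]
      filter_upwards [(memLp_E U b hb r (Lp.memLp f)).coeFn_toLp] with x h1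
      rw [h1, norm_Ef, one_mul])

lemma EE_coe (r : ℤ × ℤ) (f : Lp K 2 hh) :
    EE U b hb r f =ᵐ[hh] fun x => (fourier (-r.2) x : ℂ) • (Ua U b hb x ^ r.1) (f x) :=
  (memLp_E U b hb r (Lp.memLp f)).coeFn_toLp

lemma EE_EE (r s : ℤ × ℤ) (f : Lp K 2 hh) : EE U b hb r (EE U b hb s f) = EE U b hb (r + s) f := by
  apply Lp.ext
  filter_upwards [EE_coe U b hb r (EE U b hb s f), EE_coe U b hb s f, EE_coe U b hb (r+s) f] with x h1 h2 h3
  rw [h1, h2, h3, map_smul, smul_smul, Prod.snd_add, Prod.fst_add, neg_add, fourier_add, zpow_add]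
  rfl

lemma inner_EE (r : ℤ × ℤ) (f g : Lp K 2 hh) :
    inner ℂ (EE U b hb r f) (EE U b hb r g) = inner ℂ f g := by
  rw [L2.inner_def, L2.inner_def]
  apply integral_congr_ae
  filter_upwards [EE_coe U b hb r f, EE_coe U b hb r g] with x h1 h2
  rw [h1, h2, inner_smul_left, inner_smul_right, LinearIsometryEquiv.inner_map_map, ← mul_assoc,
    ← fourier_neg, fneg_mul', one_mul]

end op

section coef
variable {K : Type*} [NormedAddCommGroup K] [InnerProductSpace ℂ K] [CompleteSpace K]

/-- Fourier coefficients of `K`-valued functions. -/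
noncomputable def cf (G : TT → K) (k : ℤ) : K := ∫ x, (fourier (-k) x : ℂ) • G x ∂hh

variable (U : K ≃ₗᵢ[ℂ] K) (b : K) (hb : ‖b‖ = 1)

/-- The truncated operator `U (1 - b b*)`. -/
noncomputable def Tr : K →L[ℂ] K :=
  (U : K →L[ℂ] K) - (innerSL ℂ b).smulRight (U b)

lemma Tr_apply (g : K) : Tr U b g = U g - (inner ℂ b g : ℂ) • U b := by
  simp [Tr]

lemma Tr_b {b : K} (hb : ‖b‖ = 1) : Tr U b b = 0 := by
  rw [Tr_apply, inner_self_eq_norm_sq_to_K, hb]; norm_num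

lemma cf_int {G : TT → K} (hG : Continuous G) (k : ℤ) :
    Integrable (fun x => (fourier (-k) x : ℂ) • G x) hh :=
  (((fourier (-k)).continuous).smul hG).integrable_of_hasCompactSupport (HasCompactSupport.of_compactSpace _)

lemma cf_step {G : TT → K} (hG : Continuous G) (k : ℤ) :
    cf (fun x => Ua U b hb x (G x)) k = Tr U b (cf G k) + (inner ℂ b (cf G (k - 1)) : ℂ) • U b := by
  unfold cf
  rw [← ContinuousLinearMap.integral_comp_comm _ (cf_int hG k), ← integral_inner (cf_int hG _),
    ← integral_smul_const, ← integral_add]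
  · congr 1
    ext x
    beta_reduce
    rw [Ua_apply, Tr_apply, map_smul, inner_smul_right, inner_smul_right]
    have : -(k-1) = -k + 1 := by ring
    rw [this, fourier_add]
    module
  · exact (Tr U b).integrable_comp (cf_int hG k)
  · exact ((cf_int hG (k-1)).const_inner b).smul_const _

lemma cf_const (f : K) (k : ℤ) : cf (fun _ => f) k = if k = 0 then f else 0 := by
  unfold cf
  rw [integral_smul_const, int_fourier]
  by_cases h : k = 0 <;> simp [h]

lemma Ua_pow_cont (f : K) (n : ℕ) : Continuous fun x => (Ua U b hb x ^ n) f := by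
  have := (Ua_zpow_cont U b hb n).comp (f := fun x : TT => (x, f)) (by fun_prop)
  exact this.congr fun x => by simp

lemma cf_succ (f : K) (n : ℕ) (k : ℤ) :
    cf (fun x => (Ua U b hb x ^ (n+1)) f) k = Tr U b (cf (fun x => (Ua U b hb x ^ n) f) k)
      + (inner ℂ b (cf (fun x => (Ua U b hb x ^ n) f) (k - 1)) : ℂ) • U b := by
  rw [← cf_step U b hb (Ua_pow_cont U b hb f n)]
  simp only [pow_succ']; rfl

lemma cf_neg (f : K) (n : ℕ) : ∀ (k : ℤ), k < 0 → cf (fun x => (Ua U b hb x ^ n) f) k = 0 := by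
  induction n with
  | zero => intro k hk; simp only [pow_zero]; rw [show (fun _ : TT => (1 : K ≃ₗᵢ[ℂ] K) f) = fun _ => f from rfl, cf_const, if_neg hk.ne]
  | succ n ih =>
    intro k hk
    rw [cf_succ, ih k hk, ih (k-1) (by omega)]; simp

lemma cf_zero (f : K) (n : ℕ) : cf (fun x => (Ua U b hb x ^ n) f) 0 = (Tr U b ^ n) f := by
  induction n with
  | zero => simp only [pow_zero]; rw [show (fun _ : TT => (1 : K ≃ₗᵢ[ℂ] K) f) = fun _ => f from rfl, cf_const]; simp
  | succ n ih =>
    rw [cf_succ, ih, cf_neg _ _ _ _ _ _ (by norm_num), pow_succ']; simp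

lemma cf_pos (n : ℕ) (k : ℕ) : cf (fun x => (Ua U b hb x ^ n) b) ((k:ℤ) + 1) =
    ∑ j ∈ Finset.range n, (inner ℂ b (cf (fun x => (Ua U b hb x ^ (n - 1 - j)) b) k) : ℂ) • (Tr U b ^ j) (U b) := by
  induction n with
  | zero =>
    simp only [pow_zero]; rw [show (fun _ : TT => (1 : K ≃ₗᵢ[ℂ] K) b) = fun _ => b from rfl, cf_const, if_neg (by omega)]; simp
  | succ n ih =>
    rw [cf_succ, ih, Finset.sum_range_succ', map_sum]
    congr 1
    · apply Finset.sum_congr rfl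
      intro j hj
      rw [map_smul, pow_succ']
      have : n + 1 - 1 - (j + 1) = n - 1 - j := by omega
      rw [this]; rfl
    · simp

/-- The moments. -/
noncomputable def cc (r : ℤ × ℤ) : ℂ := ∫ x, fourier (-r.2) x * inner ℂ b ((Ua U b hb x ^ r.1) b) ∂hh

lemma cc_nat (n : ℕ) (k : ℤ) : cc U b hb (n, k) = inner ℂ b (cf (fun x => (Ua U b hb x ^ n) b) k) := by
  unfold cc cf
  rw [← integral_inner (cf_int (Ua_pow_cont U b hb b n) k)]
  congr 1
  ext x
  rw [inner_smul_right]; simp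

lemma cc_neg (r : ℤ × ℤ) : cc U b hb (-r) = conj (cc U b hb r) := by
  unfold cc
  rw [← integral_conj]
  congr 1
  ext x
  rw [map_mul, inner_conj_symm, ← fourier_neg, Prod.snd_neg, Prod.fst_neg]
  congr 1
  rw [← LinearIsometryEquiv.inner_map_map (Ua U b hb x ^ r.1)]
  congr 1
  rw [zpow_neg]
  change ((Ua U b hb x ^ r.1) * (Ua U b hb x ^ r.1)⁻¹) b = b
  rw [mul_inv_cancel]; rfl

lemma Tr_pow_b {b : K} (hb : ‖b‖ = 1) (n : ℕ) (hn : n ≠ 0) : (Tr U b ^ n) b = 0 := by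
  obtain ⟨n, rfl⟩ := Nat.exists_eq_succ_of_ne_zero hn
  rw [Nat.succ_eq_add_one, pow_succ, mul_apply_eq_comp, Tr_b U hb, map_zero]

lemma cc_M0 (n : ℤ) (hn : n ≠ 0) : cc U b hb (n, 0) = 0 := by
  have key : ∀ n : ℕ, n ≠ 0 → cc U b hb (n, 0) = 0 := by
    intro n hn
    rw [cc_nat, cf_zero, Tr_pow_b U hb n hn, inner_zero_right]
  rcases lt_or_gt_of_ne hn with h | h
  · have := cc_neg U b hb (-n, 0)
    rw [Prod.neg_mk, neg_neg, neg_zero] at this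
    rw [this]
    obtain ⟨k, hk⟩ : ∃ k : ℕ, -n = k := ⟨(-n).toNat, by omega⟩
    rw [hk, key k (by omega), map_zero]
  · obtain ⟨k, rfl⟩ : ∃ k : ℕ, n = k := ⟨n.toNat, by omega⟩
    exact key k (by omega)

lemma cc_one (j : ℕ) : cc U b hb ((j:ℤ) + 1, 1) = inner ℂ b ((Tr U b ^ j) (U b)) := by
  have h := cc_nat U b hb (j+1) 1
  have h2 := cf_pos U b hb (j+1) 0
  rw [Nat.cast_zero, zero_add] at h2
  push_cast at h
  rw [h, h2, Finset.sum_range_succ, Finset.sum_eq_zero]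
  · rw [zero_add, cf_zero, inner_smul_right]
    simp [inner_self_eq_norm_sq_to_K, hb]
  · intro i hi
    rw [Finset.mem_range] at hi
    rw [cf_zero, Tr_pow_b U hb _ (by omega), inner_zero_right, zero_smul]

lemma cc_M1 (k : ℕ) (n : ℤ) : cc U b hb (n, (k:ℤ)+1) =
    ∑ j ∈ Finset.Icc 1 n, cc U b hb (j, 1) * cc U b hb (n - j, k) := by
  rcases le_or_gt n 0 with h | h
  · rw [Finset.Icc_eq_empty (by omega), Finset.sum_empty]
    have := cc_neg U b hb (-n, -((k:ℤ)+1))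
    rw [Prod.neg_mk, neg_neg, neg_neg] at this
    rw [this]
    obtain ⟨i, hi⟩ : ∃ i : ℕ, -n = i := ⟨(-n).toNat, by omega⟩
    rw [hi, cc_nat, cf_neg _ _ _ _ _ _ (by omega), inner_zero_right, map_zero]
  · obtain ⟨i, rfl⟩ : ∃ i : ℕ, n = i := ⟨n.toNat, by omega⟩
    rw [cc_nat, cf_pos, inner_sum]
    symm
    apply Finset.sum_bij' (i := fun (a : ℤ) _ => (a - 1).toNat) (j := fun (a : ℕ) _ => (a:ℤ) + 1)
    · intro a ha; rw [Finset.mem_Icc] at ha; rw [Finset.mem_range]; omega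
    · intro a ha; rw [Finset.mem_range] at ha; rw [Finset.mem_Icc]; omega
    · intro a ha; rw [Finset.mem_Icc] at ha; omega
    · intro a ha; omega
    · intro a ha
      rw [Finset.mem_Icc] at ha
      obtain ⟨j, rfl⟩ : ∃ j : ℕ, a = (j:ℤ) + 1 := ⟨(a-1).toNat, by omega⟩
      have e1 : ((j:ℤ) + 1 - 1).toNat = j := by omega
      have e2 : (i:ℤ) - ((j:ℤ)+1) = ((i - 1 - j : ℕ) : ℤ) := by omega
      rw [e1, cc_one, e2, cc_nat, inner_smul_right, mul_comm]

end coef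
end CyclicAux

open MeasureTheory

namespace CyclicAux
open AddCircle Filter Topology ComplexConjugate

section graph
variable {L M I : Type*} [NormedAddCommGroup L] [InnerProductSpace ℂ L] [NormedAddCommGroup M]
  [InnerProductSpace ℂ M]

/-- Closure of the linear relation generated by `(e i, u i)`. -/
noncomputable def gr (e : I → L) (u : I → M) : Submodule ℂ (L × M) :=
  (Submodule.span ℂ (Set.range fun i => (e i, u i))).topologicalClosure

lemma gr_mem (e : I → L) (u : I → M) (i : I) : (e i, u i) ∈ gr e u :=
  Submodule.le_topologicalClosure _ (Submodule.subset_span ⟨i, rfl⟩)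

lemma gr_le (e : I → L) (u : I → M) (S : Submodule ℂ (L × M)) (hS : IsClosed (S : Set (L × M)))
    (h : ∀ i, (e i, u i) ∈ S) : gr e u ≤ S := by
  apply Submodule.topologicalClosure_minimal _ _ hS
  rw [Submodule.span_le]
  rintro _ ⟨i, rfl⟩
  exact h i

lemma gr_closed (e : I → L) (u : I → M) : IsClosed (gr e u : Set (L × M)) :=
  Submodule.isClosed_topologicalClosure _

/-- Submodule of pairs pairing equally with a given pair. -/
noncomputable def prS (x : L) (y : M) : Submodule ℂ (L × M) :=
  ((innerSL ℂ x).comp (ContinuousLinearMap.fst ℂ L M) - (innerSL ℂ y).comp (ContinuousLinearMap.snd ℂ L M)).ker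

lemma mem_prS (x : L) (y : M) (p : L × M) : p ∈ prS x y ↔ inner ℂ x p.1 = inner ℂ y p.2 := by
  rw [prS, LinearMap.mem_ker]
  simp [sub_eq_zero]

lemma prS_closed (x : L) (y : M) : IsClosed (prS x y : Set (L × M)) :=
  ContinuousLinearMap.isClosed_ker _

lemma gr_inner (e : I → L) (u : I → M) (h : ∀ i j, inner ℂ (e i) (e j) = inner ℂ (u i) (u j))
    {p q : L × M} (hp : p ∈ gr e u) (hq : q ∈ gr e u) : inner ℂ p.1 q.1 = inner ℂ p.2 q.2 := by
  have h1 : ∀ i, gr e u ≤ prS (e i) (u i) := fun i =>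
    gr_le e u _ (prS_closed _ _) fun j => (mem_prS _ _ _).2 (h i j)
  have h2 : gr e u ≤ prS p.1 p.2 := by
    refine gr_le e u _ (prS_closed _ _) fun j => (mem_prS _ _ _).2 ?_
    have := (mem_prS _ _ _).1 (h1 j hp)
    rw [← inner_conj_symm, this, inner_conj_symm]
  exact (mem_prS _ _ _).1 (h2 hq)

lemma gr_norm (e : I → L) (u : I → M) (h : ∀ i j, inner ℂ (e i) (e j) = inner ℂ (u i) (u j))
    {p : L × M} (hp : p ∈ gr e u) : ‖p.1‖ = ‖p.2‖ := by
  have := gr_inner e u h hp hp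
  rw [inner_self_eq_norm_sq_to_K, inner_self_eq_norm_sq_to_K] at this
  have h2 : ‖p.1‖ ^ 2 = ‖p.2‖ ^ 2 := by exact_mod_cast this
  exact (pow_left_inj₀ (norm_nonneg _) (norm_nonneg _) two_ne_zero).1 h2

lemma gr_snd_closed [CompleteSpace L] [CompleteSpace M] (e : I → L) (u : I → M)
    (h : ∀ i j, inner ℂ (e i) (e j) = inner ℂ (u i) (u j)) :
    IsClosed {y : M | ∃ x, (x, y) ∈ gr e u} := by
  have hc : CompleteSpace (gr e u) := (gr_closed e u).completeSpace_coe
  let φ : gr e u →ₗ[ℂ] M := (LinearMap.snd ℂ L M).comp (gr e u).subtype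
  have hφ : Isometry φ := by
    apply AddMonoidHomClass.isometry_of_norm
    intro p
    change ‖(p : L × M).2‖ = ‖(p : L × M)‖
    rw [Prod.norm_def, gr_norm e u h p.2, max_self]
  have := hφ.isClosedEmbedding.isClosed_range
  convert this using 1
  ext y
  constructor
  · rintro ⟨x, hx⟩; exact ⟨⟨(x, y), hx⟩, rfl⟩
  · rintro ⟨⟨⟨x, y'⟩, hx⟩, rfl⟩; exact ⟨x, hx⟩

lemma gr_inv (e : I → L) (u : I → M) (A : L →L[ℂ] L) (B : M →L[ℂ] M)
    (h : ∀ i, (A (e i), B (u i)) ∈ gr e u) {p : L × M} (hp : p ∈ gr e u) : (A p.1, B p.2) ∈ gr e u := by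
  have : gr e u ≤ (gr e u).comap (A.prodMap B).toLinearMap :=
    gr_le e u _ ((gr_closed e u).preimage (A.prodMap B).continuous) h
  exact this hp

end graph

section main
variable {K : Type*} [NormedAddCommGroup K] [InnerProductSpace ℂ K] [CompleteSpace K]
  (U : K ≃ₗᵢ[ℂ] K) (b : K) (hb : ‖b‖ = 1)

/-- Constant functions. -/
noncomputable def cst (f : K) : Lp K 2 hh := Lp.constL 2 hh ℂ f

lemma cst_coe (f : K) : cst f =ᵐ[hh] fun _ => f := Lp.coeFn_const 2 hh f

lemma cc_eq (r : ℤ × ℤ) : cc U b hb r = inner ℂ (cst b) (EE U b hb r (cst b)) := by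
  rw [L2.inner_def, cc]
  apply integral_congr_ae
  filter_upwards [cst_coe b, EE_coe U b hb r (cst b)] with x h1 h2
  rw [h1, h2, h1, inner_smul_right]

lemma cc_diff (p q : ℤ × ℤ) :
    inner ℂ (EE U b hb p (cst b)) (EE U b hb q (cst b)) = cc U b hb (q - p) := by
  rw [cc_eq, ← inner_EE U b hb p (cst b), EE_EE]
  congr 3
  abel

lemma exists_meas : ∃ m : Measure (TT × TT), IsProbabilityMeasure m ∧ ∀ r, ∫ z, ee r z ∂m = cc U b hb r := by
  apply herglotz
  · unfold cc
    simp [inner_self_eq_norm_sq_to_K, hb]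
  · intro s z
    have : ∑ p ∈ s, ∑ q ∈ s, conj (z p) * z q * cc U b hb (q - p) =
        inner ℂ (∑ p ∈ s, z p • EE U b hb p (cst b)) (∑ p ∈ s, z p • EE U b hb p (cst b)) := by
      simp_rw [sum_inner, inner_sum, inner_smul_left, inner_smul_right, cc_diff, mul_assoc]
    rw [this, inner_self_eq_norm_sq_to_K, ← RCLike.ofReal_pow]
    exact RCLike.ofReal_nonneg.2 (sq_nonneg _)

theorem unitary_main (f : K)
    (hf : f ∈ (Submodule.span ℂ (Set.range fun n : ℤ => (U ^ n) b)).topologicalClosure)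
    (h0 : ∃ n : ℕ, inner ℂ b ((U ^ n) f) ≠ 0) :
    ∀ᵐ x ∂hh,
      b ∈ (Submodule.span ℂ (Set.range fun n : ℤ => (Ua U b hb x ^ n) f)).topologicalClosure := by
  obtain ⟨m, hm, hc⟩ := exists_meas U b hb
  obtain ⟨one, hone⟩ : ∃ g : Lp ℂ 2 m, g =ᵐ[m] fun _ => 1 :=
    ⟨(memLp_const (1:ℂ)).toLp _, (memLp_const (μ := m) (p := 2) (1:ℂ)).coeFn_toLp⟩
  set e : ℤ × ℤ → Lp ℂ 2 m := fun r => mulC m (ee r) one with he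
  set u : ℤ × ℤ → Lp K 2 hh := fun r => EE U b hb r (cst b) with hu
  have mulmul : ∀ r s (g : Lp ℂ 2 m), mulC m (ee r) (mulC m (ee s) g) = mulC m (ee (r + s)) g := by
    intro r s g
    apply Lp.ext
    filter_upwards [mulC_coe m (ee r) (mulC m (ee s) g), mulC_coe m (ee s) g, mulC_coe m (ee (r+s)) g] with x h1 h2 h3
    rw [h1, h2, h3, ee_add, ContinuousMap.mul_apply, mul_assoc]
  have hinn : ∀ r (g : Lp ℂ 2 m), inner ℂ (e r) g = ∫ z, ee (-r) z * g z ∂m := by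
    intro r g
    rw [inner_Lp]
    apply integral_congr_ae
    filter_upwards [mulC_coe m (ee r) one, hone] with x h1 h2
    rw [he, h1, h2, ee_neg]; simp
  have heu : ∀ p q, inner ℂ (e p) (e q) = inner ℂ (u p) (u q) := by
    intro p q
    rw [hinn, hu, cc_diff, ← hc]
    apply integral_congr_ae
    filter_upwards [mulC_coe m (ee q) one, hone] with x h1 h2
    rw [he, h1, h2, mul_one, sub_eq_neg_add, ee_add]; rfl
  have he0 : e 0 = one := by
    apply Lp.ext
    filter_upwards [mulC_coe m (ee 0) one] with x h1
    rw [he, h1, ee_zero]; simp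
  have hu0 : u 0 = cst b := by
    apply Lp.ext
    filter_upwards [EE_coe U b hb 0 (cst b)] with x h1
    rw [hu, h1]; simp
  -- restricted index set
  set J := {r : ℤ × ℤ // r.2 = 0 ∨ r.2 = 1} with hJ
  set e1 : J → Lp ℂ 2 m := fun r => e r.1 with he1
  set u1 : J → Lp K 2 hh := fun r => u r.1 with hu1
  have hG1 : gr e1 u1 ≤ gr e u := gr_le _ _ _ (gr_closed _ _) fun i => gr_mem e u i.1
  have hGinv : ∀ r, ∀ p ∈ gr e u, (mulC m (ee r) p.1, EE U b hb r p.2) ∈ gr e u := by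
    intro r p hp
    refine gr_inv e u _ _ (fun i => ?_) hp
    rw [he, hu]
    dsimp only
    rw [mulmul, EE_EE]
    exact gr_mem e u _
  have hG1inv : ∀ n : ℤ, ∀ p ∈ gr e1 u1, (mulC m (ee (n, 0)) p.1, EE U b hb (n, 0) p.2) ∈ gr e1 u1 := by
    intro n p hp
    refine gr_inv e1 u1 _ _ (fun i => ?_) hp
    rw [he1, hu1, he, hu]
    dsimp only
    rw [mulmul, EE_EE]
    exact gr_mem e1 u1 ⟨(n, 0) + i.1, by simpa using i.2⟩
  -- submodule of good vectors
  let S : Submodule ℂ K := (((gr e1 u1).map (LinearMap.snd ℂ _ _)).comap (Lp.constL 2 hh ℂ).toLinearMap)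
  have hSmem : ∀ g, g ∈ S ↔ ∃ x, (x, cst g) ∈ gr e1 u1 := by
    intro g
    constructor
    · rintro ⟨⟨x, y⟩, h1, h2⟩
      exact ⟨x, by rw [show cst g = y from h2.symm]; exact h1⟩
    · rintro ⟨x, hx⟩
      exact ⟨(x, cst g), hx, rfl⟩
  have hSc : IsClosed (S : Set K) := by
    have h1 := gr_snd_closed e1 u1 (fun i j => heu i.1 j.1)
    have h2 := h1.preimage (Lp.constL (E := K) 2 hh ℂ).continuous
    convert h2 using 1
    ext g
    exact hSmem g
  have hSb : b ∈ S := by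
    rw [hSmem, ← hu0]
    exact ⟨_, gr_mem e1 u1 ⟨0, Or.inl rfl⟩⟩
  have hSU : ∀ g ∈ S, U g ∈ S := by
    intro g hg
    rw [hSmem] at hg ⊢
    obtain ⟨x, hx⟩ := hg
    have h1 := hG1inv 1 _ hx
    have h2 := gr_mem e1 u1 ⟨(1, 0), Or.inl rfl⟩
    have h3 := gr_mem e1 u1 ⟨(1, 1), Or.inr rfl⟩
    have h4 := Submodule.sub_mem _ h1 (Submodule.smul_mem _ (inner ℂ b g) (Submodule.sub_mem _ h2 h3))
    refine ⟨mulC m (ee (1, 0)) x - (inner ℂ b g : ℂ) • (e1 ⟨(1, 0), Or.inl rfl⟩ - e1 ⟨(1, 1), Or.inr rfl⟩), ?_⟩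
    · convert h4 using 1
      refine Prod.ext (by rfl) ?_
      dsimp only
      apply Lp.ext
      filter_upwards [cst_coe (U g), cst_coe g, cst_coe b, EE_coe U b hb (1, 0) (cst g), EE_coe U b hb (1, 0) (cst b),
        EE_coe U b hb (1, 1) (cst b),
        Lp.coeFn_sub (EE U b hb (1, 0) (cst g)) ((inner ℂ b g : ℂ) • (EE U b hb (1, 0) (cst b) - EE U b hb (1, 1) (cst b))),
        Lp.coeFn_smul (inner ℂ b g : ℂ) (EE U b hb (1, 0) (cst b) - EE U b hb (1, 1) (cst b)),
        Lp.coeFn_sub (EE U b hb (1, 0) (cst b)) (EE U b hb (1, 1) (cst b))] with x a1 a2 a3 a4 a5 a6 a7 a8 a9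
      rw [a1]
      simp only [Prod.snd_sub, Prod.smul_snd, hu1, hu]
      rw [a7, Pi.sub_apply, a8, Pi.smul_apply, a9, Pi.sub_apply, a4, a5, a6, a2, a3]
      simp only [zpow_one, neg_zero, fourier_zero, one_smul]
      rw [Ua_b, smul_smul, fneg_mul', Ua_apply]
      module
  have hSUi : ∀ g ∈ S, U⁻¹ g ∈ S := by
    intro g hg
    rw [hSmem] at hg ⊢
    obtain ⟨x, hx⟩ := hg
    have h1 := hG1inv (-1) _ hx
    have h2 := gr_mem e1 u1 ⟨(0, 0), Or.inl rfl⟩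
    have h3 := gr_mem e1 u1 ⟨(0, 1), Or.inr rfl⟩
    have h4 := Submodule.sub_mem _ h1 (Submodule.smul_mem _ (inner ℂ b (U⁻¹ g)) (Submodule.sub_mem _ h3 h2))
    refine ⟨mulC m (ee (-1, 0)) x - (inner ℂ b (U⁻¹ g) : ℂ) • (e1 ⟨(0, 1), Or.inr rfl⟩ - e1 ⟨(0, 0), Or.inl rfl⟩), ?_⟩
    · convert h4 using 1
      refine Prod.ext (by rfl) ?_
      dsimp only
      apply Lp.ext
      filter_upwards [cst_coe (U⁻¹ g), cst_coe g, cst_coe b, EE_coe U b hb (-1, 0) (cst g), EE_coe U b hb (0, 0) (cst b),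
        EE_coe U b hb (0, 1) (cst b),
        Lp.coeFn_sub (EE U b hb (-1, 0) (cst g)) ((inner ℂ b (U⁻¹ g) : ℂ) • (EE U b hb (0, 1) (cst b) - EE U b hb (0, 0) (cst b))),
        Lp.coeFn_smul (inner ℂ b (U⁻¹ g) : ℂ) (EE U b hb (0, 1) (cst b) - EE U b hb (0, 0) (cst b)),
        Lp.coeFn_sub (EE U b hb (0, 1) (cst b)) (EE U b hb (0, 0) (cst b))] with x a1 a2 a3 a4 a5 a6 a7 a8 a9
      rw [a1]
      simp only [Prod.snd_sub, Prod.smul_snd, hu1, hu]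
      rw [a7, Pi.sub_apply, a8, Pi.smul_apply, a9, Pi.sub_apply, a4, a5, a6, a2, a3]
      simp only [zpow_neg_one, zpow_zero, neg_zero, fourier_zero, one_smul]
      rw [Ua_inv_apply, show (1 : K ≃ₗᵢ[ℂ] K) b = b from rfl]
      module
  have hSall : ∀ n : ℤ, (U ^ n) b ∈ S := by
    have hp : ∀ n : ℕ, (U ^ n) b ∈ S := by
      intro n
      induction n with
      | zero => exact hSb
      | succ n ih => rw [pow_succ']; exact hSU _ ih
    have hn : ∀ n : ℕ, (U⁻¹ ^ n) b ∈ S := by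
      intro n
      induction n with
      | zero => exact hSb
      | succ n ih => rw [pow_succ']; exact hSUi _ ih
    intro n
    cases n with
    | ofNat n => simpa using hp n
    | negSucc n => rw [zpow_negSucc, ← inv_pow]; exact hn (n+1)
  have hfS : f ∈ S := by
    refine (Submodule.topologicalClosure_minimal _ ?_ hSc) hf
    rw [Submodule.span_le]
    rintro _ ⟨n, rfl⟩
    exact hSall n
  obtain ⟨w, hw⟩ := (hSmem f).1 hfS
  have hwG := hG1 hw
  have hcl : w ∈ (Submodule.span ℂ {v : Lp ℂ 2 m | ∃ (n k : ℤ), (k = 0 ∨ k = 1) ∧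
      v = mulC m (ee (n, k)) one}).topologicalClosure := by
    have : gr e1 u1 ≤ (Submodule.span ℂ {v : Lp ℂ 2 m | ∃ (n k : ℤ), (k = 0 ∨ k = 1) ∧
      v = mulC m (ee (n, k)) one}).topologicalClosure.comap (LinearMap.fst ℂ _ _) := by
      apply gr_le
      · exact (Submodule.isClosed_topologicalClosure _).preimage continuous_fst
      · intro i
        exact Submodule.le_topologicalClosure _ (Submodule.subset_span ⟨i.1.1, i.1.2, i.2, rfl⟩)
    exact this hw
  have hcfin : ∀ (n : ℕ) (g : K), ∫ x, inner ℂ ((Ua U b hb x ^ n) b) g ∂hh = inner ℂ ((Tr U b ^ n) b) g := by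
    intro n g
    rw [← cf_zero U b hb b n, cf, ← inner_conj_symm, ← integral_inner (cf_int (Ua_pow_cont U b hb b n) 0), ← integral_conj]
    congr 1
    ext x
    simp
  have hcfin2 : ∀ (n : ℕ) (g : K), ∫ x, inner ℂ b ((Ua U b hb x ^ n) g) ∂hh = inner ℂ b ((Tr U b ^ n) g) := by
    intro n g
    rw [← cf_zero U b hb g n, cf, ← integral_inner (cf_int (Ua_pow_cont U b hb g n) 0)]
    congr 1
    ext x
    simp
  have H1 : ∀ n : ℕ, ∫ z, ee (-((n:ℤ)+1), 0) z * w z ∂m = 0 := by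
    intro n
    have h := hinn ((n:ℤ)+1, 0) w
    rw [Prod.neg_mk, neg_zero] at h
    rw [← h, gr_inner e u heu (gr_mem e u _) hwG, L2.inner_def]
    have h2 : inner ℂ ((Tr U b ^ (n+1)) b) f = 0 := by
      rw [Tr_pow_b U hb _ (by omega), inner_zero_left]
    rw [← h2, ← hcfin]
    apply integral_congr_ae
    filter_upwards [EE_coe U b hb ((n:ℤ)+1, 0) (cst b), cst_coe f, cst_coe b] with x a1 a2 a3
    rw [hu, a1, a2, a3]
    simp only [neg_zero, fourier_zero, one_smul]
    congr 2
  have H2 : ∃ n : ℤ, ∫ z, ee (n, 0) z * w z ∂m ≠ 0 := by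
    by_contra hcon
    push Not at hcon
    have hT : ∀ n : ℕ, inner ℂ b ((Tr U b ^ n) f) = 0 := by
      intro n
      have h := hinn (-(n:ℤ), 0) w
      rw [Prod.neg_mk, neg_zero, neg_neg, hcon, gr_inner e u heu (gr_mem e u _) hwG] at h
      rw [← hcfin2, ← h, L2.inner_def]
      apply integral_congr_ae
      filter_upwards [EE_coe U b hb (-(n:ℤ), 0) (cst b), cst_coe f, cst_coe b] with x a1 a2 a3
      rw [hu, a1, a2, a3]
      simp only [neg_zero, fourier_zero, one_smul]
      rw [← LinearIsometryEquiv.inner_map_map (Ua U b hb x ^ n) ((Ua U b hb x ^ (-(n:ℤ))) b) f]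
      congr 1
      rw [zpow_neg, zpow_natCast]
      change b = ((Ua U b hb x ^ n) * (Ua U b hb x ^ n)⁻¹) b
      rw [mul_inv_cancel]; rfl
    have hTU : ∀ n : ℕ, (Tr U b ^ n) f = (U ^ n) f := by
      intro n
      induction n with
      | zero => rfl
      | succ n ih =>
        rw [pow_succ', mul_apply_eq_comp, Tr_apply, hT, zero_smul, sub_zero, ih, pow_succ']
        rfl
    obtain ⟨n, hn⟩ := h0
    exact hn (by rw [← hTU]; exact hT n)
  choose l hl using fun i : ℕ => measure_main m (cc U b hb) hc (cc_M0 U b hb) (cc_M1 U b hb) one hone w hcl H1 H2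
    ((1/2)^i) (by positivity)
  set F : ℕ → Lp K 2 hh := fun i => cst b - (l i).sum fun r a => a • EE U b hb r (cst f) with hF
  have hFn : ∀ i, ‖F i‖ < (1/2)^i := by
    intro i
    refine lt_of_eq_of_lt ?_ (hl i)
    have hG : (one - (l i).sum fun r a => a • mulC m (ee r) w, F i) ∈ gr e u := by
      have h1 : (one, cst b) ∈ gr e u := by rw [← he0, ← hu0]; exact gr_mem e u 0
      have h2 : ∑ r ∈ (l i).support, (l i r) • (mulC m (ee r) w, EE U b hb r (cst f)) ∈ gr e u :=
        Submodule.sum_mem _ fun r _ => Submodule.smul_mem _ _ (hGinv r _ hwG)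
      convert Submodule.sub_mem _ h1 h2 using 1
      refine Prod.ext ?_ ?_
      · simp [Finsupp.sum, Prod.fst_sum]
      · simp [Finsupp.sum, Prod.snd_sum, hF]
    exact (gr_norm e u heu hG).symm
  have hFt : Tendsto F atTop (𝓝 0) := by
    rw [tendsto_zero_iff_norm_tendsto_zero]
    exact squeeze_zero (fun _ => norm_nonneg _) (fun i => (hFn i).le)
      (tendsto_pow_atTop_nhds_zero_of_lt_one (by norm_num) (by norm_num))
  have hme := tendstoInMeasure_of_tendsto_Lp hFt
  obtain ⟨ns, -, hns⟩ := hme.exists_seq_tendsto_ae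
  have hsum : ∀ᵐ x ∂hh, ∀ i, F i x ∈ (fun v => b - v) ''
      (Submodule.span ℂ (Set.range fun n : ℤ => (Ua U b hb x ^ n) f) : Set K) := by
    rw [ae_all_iff]
    intro i
    have hs : ∀ᵐ x ∂hh, ∀ r, EE U b hb r (cst f) x ∈ Submodule.span ℂ (Set.range fun n : ℤ => (Ua U b hb x ^ n) f) := by
      rw [ae_all_iff]
      intro r
      filter_upwards [EE_coe U b hb r (cst f), cst_coe f] with x a1 a2
      rw [a1, a2]
      exact Submodule.smul_mem _ _ (Submodule.subset_span ⟨r.1, rfl⟩)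
    have hs2 : ∀ t : Finset (ℤ × ℤ), ∀ᵐ x ∂hh, (∑ r ∈ t, (l i r) • EE U b hb r (cst f) : Lp K 2 hh) x ∈
        Submodule.span ℂ (Set.range fun n : ℤ => (Ua U b hb x ^ n) f) := by
      intro t
      induction t using Finset.induction_on with
      | empty =>
        simp only [Finset.sum_empty]
        filter_upwards [Lp.coeFn_zero K 2 hh] with x a
        rw [a]; exact Submodule.zero_mem _
      | insert r t hr ih =>
        rw [Finset.sum_insert hr]
        filter_upwards [ih, hs, Lp.coeFn_add ((l i r) • EE U b hb r (cst f)) (∑ r ∈ t, (l i r) • EE U b hb r (cst f)),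
          Lp.coeFn_smul (l i r) (EE U b hb r (cst f))] with x a1 a2 a3 a4
        rw [a3, Pi.add_apply, a4]
        exact Submodule.add_mem _ (Submodule.smul_mem _ _ (a2 r)) a1
    filter_upwards [hs2 (l i).support, Lp.coeFn_sub (cst b) ((l i).sum fun r a => a • EE U b hb r (cst f)), cst_coe b] with x a1 a2 a3
    refine ⟨_, a1, ?_⟩
    rw [hF]
    dsimp only
    rw [a2, Pi.sub_apply, a3]; rfl
  filter_upwards [hns, hsum, Lp.coeFn_zero K 2 hh] with x h1 h2 h3
  rw [h3] at h1
  choose v hv hv2 using h2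
  have hlim : Tendsto (fun i => v (ns i)) atTop (𝓝 b) := by
    have h4 : Tendsto (fun i => b - F (ns i) x) atTop (𝓝 (b - 0)) := tendsto_const_nhds.sub h1
    rw [sub_zero] at h4
    refine h4.congr fun i => ?_
    rw [← hv2]; simp
  exact mem_closure_of_tendsto hlim (Eventually.of_forall fun i => hv _)

end main
end CyclicAux

open MeasureTheory

namespace CyclicAux
set_option linter.unusedSectionVars false
open Filter Topology ComplexConjugate

section cay
variable {K : Type*} [NormedAddCommGroup K] [InnerProductSpace ℂ K] [CompleteSpace K]

/-- cyclic subspace -/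
noncomputable def Cy (A : K →L[ℂ] K) (v : K) : Submodule ℂ K :=
  (Submodule.span ℂ (Set.range fun k : ℕ => (A ^ k) v)).topologicalClosure

lemma Cy_closed (A : K →L[ℂ] K) (v : K) : IsClosed (Cy A v : Set K) :=
  Submodule.isClosed_topologicalClosure _

lemma Cy_pow (A : K →L[ℂ] K) (v : K) (k : ℕ) : (A ^ k) v ∈ Cy A v :=
  Submodule.le_topologicalClosure _ (Submodule.subset_span ⟨k, rfl⟩)

lemma Cy_self (A : K →L[ℂ] K) (v : K) : v ∈ Cy A v := Cy_pow A v 0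

lemma clos_min (A : K →L[ℂ] K) {ι : Type*} (v : ι → K) (S : Submodule ℂ K) (hS : IsClosed (S : Set K))
    (h : ∀ i, A (v i) ∈ S) {g : K}
    (hg : g ∈ (Submodule.span ℂ (Set.range v)).topologicalClosure) : A g ∈ S := by
  have : (Submodule.span ℂ (Set.range v)).topologicalClosure ≤ S.comap A.toLinearMap := by
    apply Submodule.topologicalClosure_minimal
    · rw [Submodule.span_le]
      rintro _ ⟨i, rfl⟩
      exact h i
    · exact hS.preimage A.continuous
  exact this hg

lemma Cy_inv (A : K →L[ℂ] K) (v : K) {g : K} (hg : g ∈ Cy A v) : A g ∈ Cy A v := by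
  refine clos_min A _ _ (Cy_closed A v) (fun k => ?_) hg
  have := Cy_pow A v (k+1)
  rwa [pow_succ'] at this

lemma Cy_le (A : K →L[ℂ] K) (v : K) (S : Submodule ℂ K) (hS : IsClosed (S : Set K))
    (hA : ∀ g ∈ S, A g ∈ S) (hv : v ∈ S) : Cy A v ≤ S := by
  intro g hg
  refine clos_min (1 : K →L[ℂ] K) _ _ hS (fun k => ?_) hg
  change (A ^ k) v ∈ S
  induction k with
  | zero => exact hv
  | succ n ih => rw [pow_succ']; exact hA _ ih

lemma reduce (L : K → K) (hadd : ∀ x y, L (x + y) = L x + L y) (hinj : ∀ x, L x = 0 → x = 0)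
    (S : Submodule ℂ K) (hS : IsClosed (S : Set K)) (h1 : ∀ x ∈ S, L x ∈ S) (h2 : ∀ x ∈ Sᗮ, L x ∈ Sᗮ)
    {h : K} (hh : L h ∈ S) : h ∈ S := by
  have : CompleteSpace S := hS.completeSpace_coe
  obtain ⟨s, hs, s', hs', rfl⟩ := S.exists_add_mem_mem_orthogonal h
  have h3 : L s' ∈ S := by
    have := Submodule.sub_mem _ hh (h1 s hs)
    rwa [hadd, add_sub_cancel_left] at this
  have h4 : L s' = 0 := by
    have := (h2 s' hs') _ h3
    exact inner_self_eq_zero.1 this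
  rw [hinj _ h4, add_zero]
  exact hs

lemma orth_inv (A B : K → K) (hAB : ∀ x y, inner ℂ (A x) y = inner ℂ x (B y)) (S : Submodule ℂ K)
    (hA : ∀ g ∈ S, A g ∈ S) : ∀ g ∈ Sᗮ, B g ∈ Sᗮ := by
  intro g hg u hu
  rw [← hAB]
  exact hg _ (hA u hu)

variable (A : K →L[ℂ] K) (hA : IsSelfAdjoint A)

lemma sa_inner {A : K →L[ℂ] K} (hA : IsSelfAdjoint A) (x y : K) : inner ℂ (A x) y = inner ℂ x (A y) :=
  (ContinuousLinearMap.isSelfAdjoint_iff_isSymmetric.1 hA) x y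

lemma sa_im {A : K →L[ℂ] K} (hA : IsSelfAdjoint A) (x : K) : (inner ℂ x (A x) : ℂ).im = 0 := by
  have h := sa_inner hA x x
  rw [← inner_conj_symm] at h
  have := congrArg Complex.im h
  rw [Complex.conj_im] at this
  linarith

lemma cay_norm {A : K →L[ℂ] K} (hA : IsSelfAdjoint A) (κ : ℝ) (g : K) :
    ‖A g + (Complex.I * κ) • g‖ ^ 2 = ‖A g‖ ^ 2 + κ ^ 2 * ‖g‖ ^ 2 := by
  rw [norm_add_sq (𝕜 := ℂ), inner_smul_right, norm_smul, sa_inner hA]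
  have h := sa_im hA g
  have : RCLike.re (Complex.I * (κ:ℂ) * inner ℂ g (A g)) = 0 := by
    change (Complex.I * (κ:ℂ) * inner ℂ g (A g)).re = 0
    simp [h]
  rw [this]
  simp [mul_pow]

lemma cay_surj {A : K →L[ℂ] K} (hA : IsSelfAdjoint A) (κ : ℝ) (hκ : κ ≠ 0) (h : K) :
    ∃ g, A g + (Complex.I * κ) • g = h := by
  have h1 : -(Complex.I * (κ:ℂ)) ∉ spectrum ℂ A := by
    intro hmem
    have := hA.im_eq_zero_of_mem_spectrum hmem
    simp at this
    exact hκ this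
  rw [spectrum.notMem_iff] at h1
  obtain ⟨u, hu⟩ := h1
  refine ⟨-(((u⁻¹ : (K →L[ℂ] K)ˣ) : K →L[ℂ] K) h), ?_⟩
  have h2 : (u : K →L[ℂ] K) (((u⁻¹ : (K →L[ℂ] K)ˣ) : K →L[ℂ] K) h) = h := by
    change ((u * u⁻¹ : (K →L[ℂ] K)ˣ) : K →L[ℂ] K) h = h
    simp
  rw [hu, Algebra.algebraMap_eq_smul_one] at h2
  simp at h2
  rw [map_neg, smul_neg]
  refine Eq.trans ?_ h2
  abel

lemma cayley {A : K →L[ℂ] K} (hA : IsSelfAdjoint A) (κ : ℝ) (hκ : κ ≠ 0) :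
    ∃ U : K ≃ₗᵢ[ℂ] K, ∀ g, U (A g + (Complex.I * κ) • g) = A g - (Complex.I * κ) • g := by
  have hn : ∀ g, ‖A g - (Complex.I * κ) • g‖ = ‖A g + (Complex.I * κ) • g‖ := by
    intro g
    have h1 := cay_norm hA κ g
    have h2 := cay_norm hA (-κ) g
    rw [neg_sq, ← h1] at h2
    refine (pow_left_inj₀ (norm_nonneg _) (norm_nonneg _) two_ne_zero).1 ?_
    rw [← h2]
    simp [sub_eq_add_neg]
  choose R hR using cay_surj hA κ hκ
  have hinj : ∀ g g', A g + (Complex.I * κ) • g = A g' + (Complex.I * κ) • g' → g = g' := by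
    intro g g' h
    have h1 := cay_norm hA κ (g - g')
    have h2 : A (g - g') + (Complex.I * κ) • (g - g') = 0 := by
      rw [map_sub, smul_sub]
      rw [← sub_eq_zero] at h
      rw [← h]; abel
    rw [h2] at h1
    have h3 : 0 < κ ^ 2 := by positivity
    have h4 : ‖g - g'‖ ^ 2 = 0 := by
      simp at h1
      nlinarith [sq_nonneg ‖g - g'‖, sq_nonneg ‖A g - A g'‖]
    rw [← sub_eq_zero]
    simpa using h4
  have hRl : ∀ g, R (A g + (Complex.I * κ) • g) = g := fun g => hinj _ _ (hR _)
  let T : K →ₗ[ℂ] K :=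
    { toFun := fun h => A (R h) - (Complex.I * κ) • R h
      map_add' := by
        intro x y
        have : R (x + y) = R x + R y := by
          apply hinj; rw [hR, map_add, smul_add]
          nth_rw 1 [← hR x, ← hR y]; abel
        rw [this, map_add, smul_add]; abel
      map_smul' := by
        intro a x
        have : R (a • x) = a • R x := by
          apply hinj; rw [hR, map_smul, smul_comm, ← smul_add, hR]
        rw [this, map_smul, smul_comm, ← smul_sub]; rfl }
  let T' : K →ₗᵢ[ℂ] K := ⟨T, fun h => by
    change ‖A (R h) - (Complex.I * κ) • R h‖ = ‖h‖
    rw [hn, hR]⟩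
  have hs : Function.Surjective T' := by
    intro h
    obtain ⟨g, hg⟩ := cay_surj hA (-κ) (neg_ne_zero.2 hκ) h
    refine ⟨A g + (Complex.I * κ) • g, ?_⟩
    change A (R _) - (Complex.I * κ) • R _ = h
    rw [hRl, ← hg]
    simp [sub_eq_add_neg]
  refine ⟨LinearIsometryEquiv.ofSurjective T' hs, fun g => ?_⟩
  change A (R _) - (Complex.I * κ) • R _ = _
  rw [hRl]

end cay
end CyclicAux

open MeasureTheory

namespace CyclicAux
set_option linter.unusedSectionVars false
open Filter Topology ComplexConjugate

section tr
variable {K : Type*} [NormedAddCommGroup K] [InnerProductSpace ℂ K] [CompleteSpace K]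

/-- rank one perturbation -/
noncomputable def pert (A : K →L[ℂ] K) (δ : K) (t : ℝ) : K →L[ℂ] K :=
  A + (t : ℂ) • ((innerSL ℂ δ).smulRight δ)

lemma pert_apply (A : K →L[ℂ] K) (δ : K) (t : ℝ) (g : K) :
    pert A δ t g = A g + ((t:ℂ) * inner ℂ δ g) • δ := by
  change A g + (t:ℂ) • ((inner ℂ δ g : ℂ) • δ) = _
  rw [smul_smul]

lemma pert_sa {A : K →L[ℂ] K} (hA : IsSelfAdjoint A) (δ : K) (t : ℝ) : IsSelfAdjoint (pert A δ t) := by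
  rw [ContinuousLinearMap.isSelfAdjoint_iff_isSymmetric]
  intro x y
  change inner ℂ (pert A δ t x) y = inner ℂ x (pert A δ t y)
  rw [pert_apply, pert_apply, inner_add_left, inner_add_right, inner_smul_left, inner_smul_right, sa_inner hA,
    map_mul, Complex.conj_ofReal, inner_conj_symm]
  ring

lemma null_transfer {N : Set TT} (hN : hh N = 0) (p a : ℝ) (hp : p ≠ 0) :
    volume {t : ℝ | ∃ x ∈ N, fourier 1 x * ((1:ℂ) + t * (a - Complex.I * p)) = 1 + t * (a + Complex.I * p)} = 0 := by
  have h1 : (volume : Measure TT) N = 0 := by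
    rw [AddCircle.volume_eq_smul_haarAddCircle]
    simp only [Measure.smul_apply]
    rw [show AddCircle.haarAddCircle N = 0 from hN]; simp
  have h2 := (AddCircle.measurePreserving_mk (1:ℝ) 0).quasiMeasurePreserving.preimage_null h1
  rw [Measure.restrict_apply' measurableSet_Ioc] at h2
  set M : Set ℝ := (QuotientAddGroup.mk ⁻¹' N : Set ℝ) ∩ Set.Ioc 0 (0 + 1) with hM
  set D : ℝ → ℝ := fun θ => p * Real.cos (Real.pi * θ) - a * Real.sin (Real.pi * θ) with hD
  set G : ℝ → ℝ := fun θ => Real.sin (Real.pi * θ) / D θ with hG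
  have h3 : volume (M ∩ {θ | D θ ≠ 0}) = 0 := measure_mono_null Set.inter_subset_left h2
  have h4 : DifferentiableOn ℝ G (M ∩ {θ | D θ ≠ 0}) := by
    intro θ hθ
    apply DifferentiableAt.differentiableWithinAt
    apply DifferentiableAt.div
    · fun_prop
    · fun_prop
    · exact hθ.2
  refine measure_mono_null ?_ (addHaar_image_eq_zero_of_differentiableOn_of_addHaar_eq_zero volume h4 h3)
  rintro t ⟨x, hx, ht⟩
  obtain ⟨θ, hθ, rfl⟩ : ∃ θ ∈ Set.Ioc (0:ℝ) (0+1), (θ : TT) = x := by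
    have := AddCircle.coe_image_Ioc_eq (1:ℝ) 0
    have hx' : x ∈ (Set.univ : Set TT) := trivial
    rw [← this] at hx'
    exact hx'
  set η := Real.pi * θ with hη
  have hE : (fourier 1 (θ : TT) : ℂ) = Complex.exp (η * Complex.I) * Complex.exp (η * Complex.I) := by
    rw [fourier_coe_apply, ← Complex.exp_add]
    congr 1
    rw [hη]; push_cast; ring
  have hE2 : Complex.exp (-η * Complex.I) * Complex.exp (η * Complex.I) = 1 := by
    rw [← Complex.exp_add]; simp
  have h5 : Complex.exp (η * Complex.I) * ((1:ℂ) + t * (a - Complex.I * p)) =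
      Complex.exp (-η * Complex.I) * (1 + t * (a + Complex.I * p)) := by
    rw [← ht, hE]
    linear_combination (- Complex.exp (η * Complex.I) * ((1:ℂ) + t * (a - Complex.I * p))) * hE2
  have h6 : Real.sin η * (1 + t * a) = p * t * Real.cos η := by
    have h7 := congrArg Complex.im h5
    have e2 : Complex.exp (-η * Complex.I) = Real.cos η - Real.sin η * Complex.I := by
      rw [← Complex.ofReal_neg, Complex.exp_mul_I]
      simp [← Complex.ofReal_cos, ← Complex.ofReal_sin, sub_eq_add_neg]
    rw [e2, Complex.exp_mul_I, ← Complex.ofReal_cos, ← Complex.ofReal_sin] at h7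
    simp [-Complex.ofReal_cos, -Complex.ofReal_sin] at h7
    linarith
  have h8 : t * D θ = Real.sin η := by
    rw [hD]; simp only [← hη]; linarith
  have h9 : D θ ≠ 0 := by
    intro h0
    have h10 : Real.sin η = 0 := by rw [← h8, h0, mul_zero]
    have h11 : p * Real.cos η = 0 := by
      have : p * Real.cos η - a * Real.sin η = 0 := h0
      rwa [h10, mul_zero, sub_zero] at this
    have h12 : Real.cos η = 0 := by simpa [hp] using h11
    have := Real.sin_sq_add_cos_sq η
    rw [h10, h12] at this
    norm_num at this
  refine ⟨θ, ⟨⟨hx, hθ⟩, h9⟩, ?_⟩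
  rw [hG]; simp only [← hη]
  rw [div_eq_iff h9, h8]

lemma zpow_inv_mem (U : K ≃ₗᵢ[ℂ] K) (S : Submodule ℂ K) (h1 : ∀ g ∈ S, U g ∈ S) (h2 : ∀ g ∈ S, U⁻¹ g ∈ S)
    {f : K} (hf : f ∈ S) (n : ℤ) : (U ^ n) f ∈ S := by
  have hp : ∀ n : ℕ, (U ^ n) f ∈ S := by
    intro n
    induction n with
    | zero => exact hf
    | succ n ih => rw [pow_succ']; exact h1 _ ih
  have hn : ∀ n : ℕ, (U⁻¹ ^ n) f ∈ S := by
    intro n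
    induction n with
    | zero => exact hf
    | succ n ih => rw [pow_succ']; exact h2 _ ih
  cases n with
  | ofNat n => simpa using hp n
  | negSucc n => rw [zpow_negSucc, ← inv_pow]; exact hn (n+1)

lemma U_Uinv (U : K ≃ₗᵢ[ℂ] K) (g : K) : U (U⁻¹ g) = g := by
  change (U * U⁻¹) g = g
  rw [mul_inv_cancel]; rfl

lemma Uinv_U (U : K ≃ₗᵢ[ℂ] K) (g : K) : U⁻¹ (U g) = g := by
  change (U⁻¹ * U) g = g
  rw [inv_mul_cancel]; rfl

lemma cay_inj {A : K →L[ℂ] K} (hA : IsSelfAdjoint A) (κ : ℝ) (hκ : κ ≠ 0) (g : K)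
    (h : A g + (Complex.I * κ) • g = 0) : g = 0 := by
  have h1 := cay_norm hA κ g
  rw [h] at h1
  have h3 : 0 < κ ^ 2 := by positivity
  have h4 : ‖g‖ ^ 2 = 0 := by
    simp at h1
    nlinarith [sq_nonneg ‖g‖, sq_nonneg ‖A g‖]
  simpa using h4

lemma cay_sub_norm {A : K →L[ℂ] K} (hA : IsSelfAdjoint A) (κ : ℝ) (g : K) :
    A g - (Complex.I * κ) • g = A g + (Complex.I * (-κ : ℝ)) • g := by
  simp [sub_eq_add_neg]

/-- `A`-invariant closed subspaces are invariant under Cayley transforms. -/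
lemma cay_fwd {A : K →L[ℂ] K} (hA : IsSelfAdjoint A) (κ : ℝ) (hκ : κ ≠ 0) (U : K ≃ₗᵢ[ℂ] K)
    (hU : ∀ g, U (A g + (Complex.I * κ) • g) = A g - (Complex.I * κ) • g)
    (S : Submodule ℂ K) (hS : IsClosed (S : Set K)) (hAS : ∀ g ∈ S, A g ∈ S) :
    (∀ g ∈ S, U g ∈ S) ∧ ∀ g ∈ S, U⁻¹ g ∈ S := by
  have hAo := orth_inv A A (sa_inner hA) S hAS
  have key : ∀ κ : ℝ, κ ≠ 0 → ∀ g, A g + (Complex.I * κ) • g ∈ S → g ∈ S := by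
    intro κ hκ g hg
    refine reduce (fun g => A g + (Complex.I * κ) • g) ?_ (cay_inj hA κ hκ) S hS ?_ ?_ hg
    · intro x y; simp only [map_add, smul_add]; abel
    · intro x hx; exact Submodule.add_mem _ (hAS x hx) (Submodule.smul_mem _ _ hx)
    · intro x hx; exact Submodule.add_mem _ (hAo x hx) (Submodule.smul_mem _ _ hx)
  constructor
  · intro h hh
    obtain ⟨g, rfl⟩ := cay_surj hA κ hκ h
    have := key κ hκ g hh
    rw [hU]
    exact Submodule.sub_mem _ (hAS _ this) (Submodule.smul_mem _ _ this)
  · intro h hh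
    obtain ⟨g, rfl⟩ := cay_surj hA (-κ) (neg_ne_zero.2 hκ) h
    have := key (-κ) (neg_ne_zero.2 hκ) g hh
    rw [← cay_sub_norm hA, ← hU, Uinv_U]
    exact Submodule.add_mem _ (hAS _ this) (Submodule.smul_mem _ _ this)

lemma U_inner_inv (U : K ≃ₗᵢ[ℂ] K) (x y : K) : inner ℂ (U x) y = inner ℂ x (U⁻¹ y) := by
  rw [← LinearIsometryEquiv.inner_map_map U x, U_Uinv]

lemma cay_bwd {A : K →L[ℂ] K} (κ : ℝ) (hκ : κ ≠ 0) (hA : IsSelfAdjoint A) (U : K ≃ₗᵢ[ℂ] K)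
    (hU : ∀ g, U (A g + (Complex.I * κ) • g) = A g - (Complex.I * κ) • g)
    (S : Submodule ℂ K) (hS : IsClosed (S : Set K)) (h1 : ∀ g ∈ S, U g ∈ S) (h2 : ∀ g ∈ S, U⁻¹ g ∈ S) :
    ∀ g ∈ S, A g ∈ S := by
  intro g hg
  have ho := orth_inv (fun x => U⁻¹ x) (fun x => U x) (fun x y => by
    have := U_inner_inv U⁻¹ x y
    rwa [inv_inv] at this) S h2
  have hc : ∀ g, (A g + (Complex.I * κ) • g) - U (A g + (Complex.I * κ) • g) = (2 * Complex.I * κ) • g := by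
    intro g; rw [hU]; module
  have hk : (2 * Complex.I * κ : ℂ) ≠ 0 := by simp [hκ]
  have : A g + (Complex.I * κ) • g ∈ S := by
    refine reduce (fun h => h - U h) ?_ ?_ S hS ?_ ?_ (h := A g + (Complex.I * κ) • g) ?_
    · intro x y; simp only [map_add]; abel
    · intro x hx
      obtain ⟨g, rfl⟩ := cay_surj hA κ hκ x
      rw [hc] at hx
      rw [(smul_eq_zero_iff_right hk).1 hx]; simp
    · intro x hx; exact Submodule.sub_mem _ hx (h1 x hx)
    · intro x hx; exact Submodule.sub_mem _ hx (ho x hx)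
    · simp only [hc]; exact Submodule.smul_mem _ _ hg
  have h3 := Submodule.sub_mem _ this (Submodule.smul_mem _ (Complex.I * κ) hg)
  rwa [add_sub_cancel_right] at h3

end tr
end CyclicAux

open MeasureTheory

namespace CyclicAux
open Filter Topology ComplexConjugate

section tr
variable {K : Type*} [NormedAddCommGroup K] [InnerProductSpace ℂ K] [CompleteSpace K]

/-- If `U` is close to `-1`, then closed forward invariant subspaces are backward invariant. -/
lemma inv_of_close (U : K ≃ₗᵢ[ℂ] K) (hU : ∀ h, h ≠ 0 → ‖h + U h‖ < ‖h‖)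
    (N : Submodule ℂ K) (hN : IsClosed (N : Set K)) (h1 : ∀ g ∈ N, U g ∈ N) : ∀ g ∈ N, U⁻¹ g ∈ N := by
  intro g hg
  have : CompleteSpace N := hN.completeSpace_coe
  obtain ⟨n, hn, n', hn', h⟩ := N.exists_add_mem_mem_orthogonal (U⁻¹ g)
  have h2 : U n' ∈ N := by
    have h3 : U n' = g - U n := by
      rw [eq_sub_iff_add_eq, add_comm, ← map_add, ← h, U_Uinv]
    rw [h3]
    exact Submodule.sub_mem _ hg (h1 _ hn)
  have h4 : n' = 0 := by
    by_contra h0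
    have h5 := hU n' h0
    have h6 : ‖n' + U n'‖ ^ 2 = ‖n'‖ ^ 2 + ‖U n'‖ ^ 2 := by
      have : inner ℂ n' (U n') = 0 := by
        rw [← inner_conj_symm, hn' _ h2, map_zero]
      rw [norm_add_sq (𝕜 := ℂ), this]
      simp
    nlinarith [norm_nonneg (n' + U n'), norm_nonneg n', sq_nonneg ‖U n'‖]
  rw [h, h4, add_zero]; exact hn

theorem transfer {A : K →L[ℂ] K} (hA : IsSelfAdjoint A) (δ : K) (hδ : δ ≠ 0) (f : K) (hf : f ∈ Cy A δ) (hf0 : f ≠ 0) :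
    ∀ᵐ t : ℝ, δ ∈ Cy (pert A δ t) f := by
  obtain ⟨κ, hκd⟩ : ∃ κ : ℝ, κ = 2 * ‖A‖ + 1 := ⟨_, rfl⟩
  have hκp : 0 < κ := by rw [hκd]; positivity
  have hκ := hκp.ne'
  obtain ⟨U, hU⟩ := cayley hA κ hκ
  obtain ⟨b0, hb0⟩ := cay_surj hA (-κ) (neg_ne_zero.2 hκ) δ
  rw [← cay_sub_norm hA] at hb0
  have hb0n : b0 ≠ 0 := by
    rintro rfl
    apply hδ; rw [← hb0]; simp
  have hnb : ‖b0‖ ≠ 0 := norm_ne_zero_iff.2 hb0n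
  have hnbc : (‖b0‖ : ℂ) ≠ 0 := by exact_mod_cast hnb
  obtain ⟨b, hbd⟩ : ∃ b : K, b = ((‖b0‖ : ℂ)⁻¹) • b0 := ⟨_, rfl⟩
  have hb : ‖b‖ = 1 := by rw [hbd, norm_smul]; simp [hnb]
  have hb0b : b0 = (‖b0‖ : ℂ) • b := by rw [hbd, smul_smul, mul_inv_cancel₀ hnbc, one_smul]
  -- h0
  have hclose : ∀ h, h ≠ 0 → ‖h + U h‖ < ‖h‖ := by
    intro h hh
    obtain ⟨g, rfl⟩ := cay_surj hA κ hκ h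
    have hg : g ≠ 0 := by rintro rfl; simp at hh
    have hgp : 0 < ‖g‖ := norm_pos_iff.2 hg
    have h1 := cay_norm hA κ g
    have h2 : A g + (Complex.I * κ) • g + U (A g + (Complex.I * κ) • g) = (2:ℂ) • A g := by
      rw [hU]; module
    rw [h2, norm_smul]
    have h3 := A.le_opNorm g
    have h4 : ‖(2:ℂ)‖ = 2 := by simp
    rw [h4]
    have h5 : κ * ‖g‖ ≤ ‖A g + (Complex.I * κ) • g‖ := by
      apply le_of_sq_le_sq _ (norm_nonneg _)
      rw [h1, mul_pow]; nlinarith [sq_nonneg ‖A g‖]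
    have h6 : κ * ‖g‖ = 2 * (‖A‖ * ‖g‖) + ‖g‖ := by rw [hκd]; ring
    linarith
  set C := (Submodule.span ℂ (Set.range fun n : ℤ => (U ^ n) b)).topologicalClosure with hC
  have hCc : IsClosed (C : Set K) := Submodule.isClosed_topologicalClosure _
  have hCn : ∀ n : ℤ, (U ^ n) b ∈ C := fun n => Submodule.le_topologicalClosure _ (Submodule.subset_span ⟨n, rfl⟩)
  have hCU : ∀ g ∈ C, U g ∈ C := by
    intro g hg
    refine clos_min (U.toContinuousLinearEquiv : K →L[ℂ] K) _ C hCc (fun n => ?_) hg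
    have := hCn (1 + n)
    rw [zpow_add, zpow_one] at this
    exact this
  have hCUi : ∀ g ∈ C, U⁻¹ g ∈ C := by
    intro g hg
    refine clos_min (U⁻¹.toContinuousLinearEquiv : K →L[ℂ] K) _ C hCc (fun n => ?_) hg
    have := hCn (-1 + n)
    rw [zpow_add, zpow_neg_one] at this
    exact this
  have hCA := cay_bwd κ hκ hA U hU C hCc hCU hCUi
  have hb0C : b0 ∈ C := by rw [hb0b]; exact Submodule.smul_mem _ _ (hCn 0)
  have hδC : δ ∈ C := by
    rw [← hb0]
    exact Submodule.sub_mem _ (hCA _ hb0C) (Submodule.smul_mem _ _ hb0C)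
  have hfC : f ∈ C := Cy_le A δ C hCc hCA hδC hf
  have h0 : ∃ n : ℕ, inner ℂ b ((U ^ n) f) ≠ 0 := by
    by_contra hcon
    push Not at hcon
    let N : Submodule ℂ K := ⨅ n : ℕ, LinearMap.ker ((innerSL ℂ b).toLinearMap ∘ₗ ((U ^ n).toLinearEquiv : K →ₗ[ℂ] K))
    have hNm : ∀ g, g ∈ N ↔ ∀ n : ℕ, inner ℂ b ((U ^ n) g) = 0 := by
      intro g
      simp only [N, Submodule.mem_iInf, LinearMap.mem_ker]
      rfl
    have hNc : IsClosed (N : Set K) := by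
      have : (N : Set K) = ⋂ n : ℕ, {g | inner ℂ b ((U ^ n) g) = 0} := by
        ext g; simp only [SetLike.mem_coe, hNm, Set.mem_iInter]; rfl
      rw [this]
      refine isClosed_iInter fun n => ?_
      have := (U ^ n).continuous
      exact isClosed_eq (by fun_prop) continuous_const
    have hNU : ∀ g ∈ N, U g ∈ N := by
      intro g hg
      rw [hNm] at hg ⊢
      intro n
      have := hg (n+1)
      rw [pow_succ] at this
      exact this
    have hNUi := inv_of_close U hclose N hNc hNU
    have hfN : f ∈ N := (hNm f).2 hcon
    have hall : ∀ n : ℤ, inner ℂ b ((U ^ n) f) = 0 := fun n => (hNm _).1 (zpow_inv_mem U N hNU hNUi hfN n) 0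
    have hCf : C ≤ LinearMap.ker (innerSL ℂ f).toLinearMap := by
      intro g hg
      change inner ℂ f g = 0
      have := clos_min (1 : K →L[ℂ] K) _ (LinearMap.ker (innerSL ℂ f).toLinearMap) (innerSL ℂ f).isClosed_ker
        (fun n => ?_) hg
      · exact this
      · change inner ℂ f ((U ^ n) b) = 0
        rw [← inner_conj_symm, U_inner_inv, ← zpow_neg, hall, map_zero]
    exact hf0 (inner_self_eq_zero.1 (hCf hfC))
  have hmain := unitary_main U b hb f hfC h0
  obtain ⟨N, hN, hNb⟩ : ∃ N : Set TT, hh N = 0 ∧ ∀ x, x ∉ N →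
      b ∈ (Submodule.span ℂ (Set.range fun n : ℤ => (Ua U b hb x ^ n) f)).topologicalClosure := by
    exact ⟨_, hmain, fun x hx => not_not.1 hx⟩
  obtain ⟨a, ha⟩ : ∃ a : ℝ, inner ℂ b0 (A b0) = (a : ℂ) :=
    ⟨(inner ℂ b0 (A b0) : ℂ).re, Complex.ext rfl (by rw [sa_im hA]; simp)⟩
  set p : ℝ := κ * ‖b0‖ ^ 2 with hp
  have hp0 : p ≠ 0 := by rw [hp]; positivity
  have hF : inner ℂ b0 δ = (a : ℂ) - Complex.I * p := by
    rw [← hb0, inner_sub_right, ha, inner_smul_right, inner_self_eq_norm_sq_to_K, hp]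
    push_cast
    ring_nf
    rfl
  have hnull := null_transfer hN p a hp0
  rw [ae_iff]
  refine measure_mono_null ?_ hnull
  intro t ht
  by_contra hcon
  apply ht
  change ¬ (∃ x ∈ N, _) at hcon
  push Not at hcon
  set w : ℂ := (1:ℂ) + t * (a - Complex.I * p) with hw
  have hwc : (1:ℂ) + t * (a + Complex.I * p) = conj w := by
    rw [hw]; simp
  have hw0 : w ≠ 0 := by
    intro h
    have h1 := congrArg Complex.im h
    have h2 := congrArg Complex.re h
    simp [hw] at h1 h2
    rcases h1 with h1 | h1
    · rw [h1] at h2; simp at h2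
    · exact hp0 h1
  have hwc0 : conj w ≠ 0 := by simpa using hw0
  obtain ⟨x, hx⟩ : ∃ x : TT, (fourier 1 x : ℂ) = conj w / w := by
    have hn : ‖conj w / w‖ = 1 := by rw [norm_div, RCLike.norm_conj, div_self (norm_ne_zero_iff.2 hw0)]
    obtain ⟨x, hx⟩ := (AddCircle.homeomorphCircle (T := 1) one_ne_zero).surjective ⟨conj w / w, by
      exact mem_sphere_zero_iff_norm.2 hn⟩
    refine ⟨x, ?_⟩
    rw [fourier_one]
    have := congrArg (fun z : Circle => (z : ℂ)) hx
    simpa [AddCircle.homeomorphCircle_apply] using this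
  have hxN : x ∉ N := by
    intro h
    apply hcon x h
    rw [hx, hwc, div_mul_cancel₀ _ hw0]
  have hbx := hNb x hxN
  have hAt := pert_sa hA δ t
  have hUt : ∀ g, Ua U b hb x (pert A δ t g + (Complex.I * κ) • g) = pert A δ t g - (Complex.I * κ) • g := by
    intro g
    obtain ⟨r, hr⟩ := cay_surj hA κ hκ δ
    have hUb0 : U b0 = r := by
      have h1 := hU b0
      have h2 := hU r
      rw [hr] at h2
      have h3 : A b0 + (Complex.I * κ) • b0 = δ + (2 * Complex.I * κ) • b0 := by rw [← hb0]; module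
      rw [h3, map_add, map_smul, h2, hb0, ← hr] at h1
      have h4 : (2 * Complex.I * κ) • U b0 = (2 * Complex.I * κ) • r := by
        have : (2 * Complex.I * κ) • U b0 = (A r - (Complex.I * κ) • r + (2 * Complex.I * κ) • U b0) - (A r - (Complex.I * κ) • r) := by
          abel
        rw [this, h1]; module
      exact smul_right_injective K (r := (2 * Complex.I * κ : ℂ)) (by simp [hκ]) h4
    have hUδ : U δ = δ - (2 * Complex.I * κ) • r := by
      have h2 := hU r
      rw [hr] at h2
      rw [h2, ← hr]; module
    have hbr : U b = ((‖b0‖ : ℂ)⁻¹) • r := by rw [hbd, map_smul, hUb0]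
    set γ : ℂ := inner ℂ δ g with hγ
    have hin : inner ℂ b0 (pert A δ t g + (Complex.I * κ) • g) = γ * w := by
      rw [pert_apply, inner_add_right, inner_add_right, inner_smul_right, inner_smul_right, hF, ← sa_inner hA, hw, ← hγ]
      have : γ = inner ℂ (A b0) g + (Complex.I * κ) * inner ℂ b0 g := by
        rw [hγ, ← hb0, inner_sub_left, inner_smul_left]
        simp
      linear_combination -this
    have hinb : inner ℂ b (pert A δ t g + (Complex.I * κ) • g) = (‖b0‖ : ℂ)⁻¹ * (γ * w) := by
      rw [hbd, inner_smul_left, hin]; simp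
    rw [Ua_apply, hinb, hbr, hx, smul_smul, pert_apply, ← hγ]
    have h1 : A g + (t * γ) • δ + (Complex.I * κ) • g = (A g + (Complex.I * κ) • g) + (t * γ) • δ := by abel
    rw [h1, map_add, map_smul, hU, hUδ]
    have h2 : (conj w / w - 1) * ((‖b0‖ : ℂ)⁻¹ * (γ * w)) * (‖b0‖ : ℂ)⁻¹ = t * γ * (2 * Complex.I * κ) := by
      have h3 : conj w - w = 2 * Complex.I * t * κ * ‖b0‖^2 := by
        rw [← hwc, hw, hp]; push_cast; ring
      have h4 : (conj w / w - 1) = (2 * Complex.I * t * κ * ‖b0‖^2) / w := by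
        rw [← h3]; field_simp
      rw [h4]
      field_simp
    rw [h2]
    module
  have hfw := cay_fwd hAt κ hκ _ hUt (Cy (pert A δ t) f) (Cy_closed _ _) (fun g hg => Cy_inv _ _ hg)
  have hbS : b ∈ Cy (pert A δ t) f := by
    refine clos_min (1 : K →L[ℂ] K) _ _ (Cy_closed _ _) (fun n => ?_) hbx
    exact zpow_inv_mem _ _ hfw.1 hfw.2 (Cy_self _ _) n
  have hb0S : b0 ∈ Cy (pert A δ t) f := by rw [hb0b]; exact Submodule.smul_mem _ _ hbS
  have hS : (conj w) • δ ∈ Cy (pert A δ t) f := by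
    have h1 : (conj w) • δ = pert A δ t b0 - (Complex.I * κ) • b0 := by
      rw [pert_apply]
      have h2 : inner ℂ δ b0 = (a : ℂ) + Complex.I * p := by
        rw [← inner_conj_symm, hF]; simp
      rw [h2, ← hwc]
      have h3 : A b0 = δ + (Complex.I * κ) • b0 := by rw [← hb0]; abel
      rw [h3]
      module
    rw [h1]
    exact Submodule.sub_mem _ (Cy_inv _ _ hb0S) (Submodule.smul_mem _ _ hb0S)
  have := Submodule.smul_mem _ (conj w)⁻¹ hS
  rwa [smul_smul, inv_mul_cancel₀ hwc0, one_smul] at this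

end tr
end CyclicAux

open MeasureTheory

namespace CyclicAux
open Filter Topology ComplexConjugate

section comm
variable {K : Type*} [NormedAddCommGroup K] [InnerProductSpace ℂ K] [CompleteSpace K]

/-- double commutant -/
def DC (H : K →L[ℂ] K) : Submodule ℂ (K →L[ℂ] K) where
  carrier := {T | ∀ B, Commute B H → Commute B T}
  add_mem' := fun h1 h2 B hB => (h1 B hB).add_right (h2 B hB)
  zero_mem' := fun B _ => Commute.zero_right B
  smul_mem' := fun a _ h B hB => (h B hB).smul_right a

lemma star_app (T : K →L[ℂ] K) (x y : K) : inner ℂ (star T x) y = inner ℂ x (T y) := by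
  rw [ContinuousLinearMap.star_eq_adjoint, ContinuousLinearMap.adjoint_inner_left]

lemma app_comm {S T : K →L[ℂ] K} (h : Commute S T) (x : K) : S (T x) = T (S x) :=
  congrArg (fun L : K →L[ℂ] K => L x) h

lemma commutant_comm {H : K →L[ℂ] K} (hH : IsSelfAdjoint H) (ψ : K) (hψ : Cy H ψ = ⊤)
    (P Q : K →L[ℂ] K) (hP : IsSelfAdjoint P) (hPH : Commute P H) (hQH : Commute Q H) (x : K) :
    P (Q x) = Q (P x) := by
  have hstar : ∀ T ∈ DC H, star T ∈ DC H := by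
    intro T hT B hB
    have h1 : Commute (star B) H := by
      have := hB.star_star
      rwa [hH.star_eq] at this
    have := (hT _ h1).star_star
    rwa [star_star] at this
  let M : Submodule ℂ K := (DC H).map (ContinuousLinearMap.apply ℂ K ψ).toLinearMap
  have hM : M.topologicalClosure = ⊤ := by
    rw [← top_le_iff, ← hψ]
    apply Submodule.topologicalClosure_mono
    rw [Submodule.span_le]
    rintro _ ⟨k, rfl⟩
    exact ⟨H ^ k, fun B hB => hB.pow_right k, rfl⟩
  have hMd : Dense (M : Set K) := by
    rw [dense_iff_closure_eq, ← Submodule.topologicalClosure_coe, hM]; rfl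
  obtain ⟨y, hy, hyl⟩ := mem_closure_iff_seq_limit.1 (hMd.closure_eq.symm ▸ Set.mem_univ (P ψ) : P ψ ∈ closure (M : Set K))
  choose T hT hTy using hy
  have hTy' : ∀ n, T n ψ = y n := hTy
  have hl1 : Tendsto (fun n => T n ψ) atTop (𝓝 (P ψ)) := by simp_rw [hTy']; exact hyl
  have hl2 : Tendsto (fun n => star (T n) ψ) atTop (𝓝 (P ψ)) := by
    rw [tendsto_iff_norm_sub_tendsto_zero] at hl1 ⊢
    refine hl1.congr fun n => ?_
    have hc : Commute (star (T n - P)) (T n - P) := by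
      rw [star_sub, hP.star_eq]
      have h1 : Commute P (T n) := hT n P hPH
      have h2 : Commute P (star (T n)) := hstar _ (hT n) P hPH
      have h3 : Commute (star (T n)) (T n) := by
        apply hT n
        have : Commute H (star (T n)) := hstar _ (hT n) H (Commute.refl H)
        exact this.symm
      exact (h3.sub_left h1).sub_right (h2.symm.sub_left (Commute.refl P))
    have h1 : T n ψ - P ψ = (T n - P) ψ := rfl
    have h2 : star (T n) ψ - P ψ = (star (T n - P)) ψ := by rw [star_sub, hP.star_eq]; rfl
    rw [h1, h2]
    set L := T n - P
    have h3 : (inner ℂ (star L ψ) (star L ψ) : ℂ) = inner ℂ (L ψ) (L ψ) := by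
      rw [star_app, ← app_comm hc]
      have := star_app (star L) (L ψ) ψ
      rw [star_star] at this
      rw [← inner_conj_symm, star_app, inner_conj_symm]
    rw [inner_self_eq_norm_sq_to_K, inner_self_eq_norm_sq_to_K] at h3
    have h4 : ‖star L ψ‖ ^ 2 = ‖L ψ‖ ^ 2 := by exact_mod_cast h3
    exact ((pow_left_inj₀ (norm_nonneg _) (norm_nonneg _) two_ne_zero).1 h4).symm
  have key : P (Q ψ) = Q (P ψ) := by
    apply hMd.eq_of_inner_left ℂ
    rintro _ ⟨S, hS, rfl⟩
    change inner ℂ (P (Q ψ)) (S ψ) = inner ℂ (Q (P ψ)) (S ψ)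
    have t1 : Tendsto (fun n => inner ℂ (Q (star (T n) ψ)) (S ψ)) atTop (𝓝 (inner ℂ (Q (P ψ)) (S ψ))) :=
      ((Q.continuous.tendsto _).comp hl2).inner tendsto_const_nhds
    have t2 : Tendsto (fun n => inner ℂ (Q ψ) (S (T n ψ))) atTop (𝓝 (inner ℂ (Q ψ) (S (P ψ)))) :=
      tendsto_const_nhds.inner ((S.continuous.tendsto _).comp hl1)
    have h1 : inner ℂ (P (Q ψ)) (S ψ) = inner ℂ (Q ψ) (S (P ψ)) := by
      rw [sa_inner hP, app_comm (hS P hPH)]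
    rw [h1]
    refine tendsto_nhds_unique t2 (t1.congr fun n => ?_)
    rw [app_comm (hstar _ (hT n) Q hQH), star_app]
    congr 1
    apply app_comm
    apply hS
    exact (hT n H (Commute.refl H)).symm
  have hext : (fun x => P (Q x)) = fun x => Q (P x) := by
    refine Continuous.ext_on hMd (by fun_prop) (by fun_prop) ?_
    rintro _ ⟨S, hS, rfl⟩
    change P (Q (S ψ)) = Q (P (S ψ))
    rw [app_comm (hS Q hQH), app_comm (hS P hPH), app_comm (hS P hPH), app_comm (hS Q hQH), key]
  exact congrFun hext x

lemma proj_comm {H : K →L[ℂ] K} (hH : IsSelfAdjoint H) (S : Submodule ℂ K) [S.HasOrthogonalProjection]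
    (hS : ∀ g ∈ S, H g ∈ S) : Commute S.starProjection H := by
  have ho := orth_inv H H (sa_inner hH) S hS
  ext x
  change S.starProjection (H x) = H (S.starProjection x)
  refine (Submodule.eq_starProjection_of_mem_orthogonal (hS _ (S.starProjection_apply_mem x)) ?_)
  rw [← map_sub]
  exact ho _ (Submodule.sub_starProjection_mem_orthogonal x)

theorem deloc {A : K →L[ℂ] K} (hA : IsSelfAdjoint A) (δ φ ψ : K) (hφ : ∃ g ∈ Cy A δ, inner ℂ g φ ≠ 0) :
    ∀ᵐ t : ℝ, Cy (pert A δ t) ψ = ⊤ → δ ∈ Cy (pert A δ t) φ := by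
  by_cases hδ : δ = 0
  · filter_upwards with t _
    rw [hδ]; exact Submodule.zero_mem _
  have : CompleteSpace (Cy A δ) := (Cy_closed A δ).completeSpace_coe
  set f := (Cy A δ).starProjection φ with hf
  have hfC : f ∈ Cy A δ := Submodule.starProjection_apply_mem _ _
  have hf0 : f ≠ 0 := by
    intro h0
    obtain ⟨g, hg, hgφ⟩ := hφ
    apply hgφ
    have := Submodule.sub_starProjection_mem_orthogonal (K := Cy A δ) φ
    rw [← hf, h0, sub_zero] at this
    exact this g hg
  filter_upwards [transfer hA δ hδ f hfC hf0] with t ht hψ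
  have hAt := pert_sa hA δ t
  have hQinv : ∀ g ∈ Cy A δ, pert A δ t g ∈ Cy A δ := by
    intro g hg
    rw [pert_apply]
    exact Submodule.add_mem _ (Cy_inv _ _ hg) (Submodule.smul_mem _ _ (Cy_self _ _))
  have hQ := proj_comm hAt (Cy A δ) hQinv
  have : CompleteSpace (Cy (pert A δ t) φ) := (Cy_closed _ φ).completeSpace_coe
  have hP := proj_comm hAt (Cy (pert A δ t) φ) (fun g hg => Cy_inv _ _ hg)
  have hc := commutant_comm hAt ψ hψ _ _ (isSelfAdjoint_starProjection (Cy (pert A δ t) φ)) hP hQ φ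
  have hPφ : (Cy (pert A δ t) φ).starProjection φ = φ := Submodule.starProjection_eq_self_iff.2 (Cy_self _ _)
  rw [hPφ] at hc
  have hfm : f ∈ Cy (pert A δ t) φ := by
    rw [hf, ← hc]; exact Submodule.starProjection_apply_mem _ _
  exact Cy_le _ f _ (Cy_closed _ _) (fun g hg => Cy_inv _ _ hg) hfm ht

end comm
end CyclicAux

open MeasureTheory

namespace CyclicAux
open Filter Topology ComplexConjugate

section lat

lemma span_fin {E : Type*} [NormedAddCommGroup E] [NormedSpace ℂ E] (u : ℕ → E) (v : E) :
    v ∈ (Submodule.span ℂ (Set.range u)).topologicalClosure ↔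
    ∀ m : ℕ, ∃ n : ℕ, ∃ i : ℕ,
      ‖v - ∑ k : Fin n, TopologicalSpace.denseSeq (Fin n → ℂ) i k • u k‖ < 1 / ((m:ℝ) + 1) := by
  have hcl : v ∈ (Submodule.span ℂ (Set.range u)).topologicalClosure ↔
      v ∈ closure (Submodule.span ℂ (Set.range u) : Set E) := by
    rw [← Submodule.topologicalClosure_coe]; rfl
  rw [hcl]
  constructor
  · intro h m
    obtain ⟨w, hw, hvw⟩ := Metric.mem_closure_iff.1 h (1 / ((m:ℝ) + 1)) (by positivity)
    obtain ⟨c, rfl⟩ := (Finsupp.mem_span_range_iff_exists_finsupp).1 hw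
    obtain ⟨n, hn⟩ : ∃ n : ℕ, c.support ⊆ Finset.range n := by
      obtain ⟨n, hn⟩ := c.support.bddAbove
      exact ⟨n + 1, fun k hk => Finset.mem_range.2 (Nat.lt_succ_of_le (hn hk))⟩
    refine ⟨n, ?_⟩
    have hs : (c.sum fun i a => a • u i) = ∑ k : Fin n, c k • u k := by
      rw [Finsupp.sum_of_support_subset c hn _ (by simp), Finset.sum_range]
    have ho : IsOpen {a : Fin n → ℂ | ‖v - ∑ k : Fin n, a k • u k‖ < 1 / ((m:ℝ) + 1)} :=
      isOpen_lt (by fun_prop) continuous_const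
    obtain ⟨i, hi⟩ := (TopologicalSpace.denseRange_denseSeq (Fin n → ℂ)).exists_mem_open ho
      ⟨fun k => c k, by change ‖v - ∑ k : Fin n, c k • u k‖ < _; rw [← hs, ← dist_eq_norm]; exact hvw⟩
    exact ⟨i, hi⟩
  · intro h
    rw [Metric.mem_closure_iff]
    intro ε hε
    obtain ⟨m, hm⟩ := exists_nat_one_div_lt hε
    obtain ⟨n, i, hi⟩ := h m
    refine ⟨∑ k : Fin n, TopologicalSpace.denseSeq (Fin n → ℂ) i k • u k, Submodule.sum_mem _ fun k _ => Submodule.smul_mem _ _ (Submodule.subset_span ⟨_, rfl⟩), ?_⟩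
    · rw [dist_eq_norm]; exact hi.trans hm

lemma meas_span {Ω E : Type*} [MeasurableSpace Ω] [NormedAddCommGroup E] [NormedSpace ℂ E] (u : ℕ → Ω → E)
    (hu : ∀ k, StronglyMeasurable (u k)) (v : E) :
    MeasurableSet {ω | v ∈ (Submodule.span ℂ (Set.range fun k => u k ω)).topologicalClosure} := by
  simp_rw [span_fin, Set.ofPred_forall, Set.ofPred_exists]
  refine MeasurableSet.iInter fun m => MeasurableSet.iUnion fun n => MeasurableSet.iUnion fun i => ?_
  refine measurableSet_lt ?_ measurable_const
  refine StronglyMeasurable.measurable (StronglyMeasurable.norm (stronglyMeasurable_const.sub ?_))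
  exact Finset.stronglyMeasurable_fun_sum _ fun k _ => (hu k).const_smul _

variable {d : ℕ}

/-- delta -/
noncomputable def dl (j : Fin d → ℤ) : lp (fun _ : Fin d → ℤ => ℂ) 2 := lp.single 2 j 1

lemma dl_apply (j x : Fin d → ℤ) : dl j x = if x = j then 1 else 0 := by
  rw [dl, lp.single_apply, Pi.single_apply]

lemma inner_dl (j : Fin d → ℤ) (f : lp (fun _ : Fin d → ℤ => ℂ) 2) : inner ℂ (dl j) f = f j := by
  rw [dl, lp.inner_single_left]; simp

lemma dl_sum (f : lp (fun _ : Fin d → ℤ => ℂ) 2) : HasSum (fun i => f i • dl i) f := by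
  have := lp.hasSum_single (p := 2) (by norm_num) f
  convert this using 2 with i
  rw [dl, ← lp.single_smul]; simp

lemma sm_coord {Ω : Type*} [MeasurableSpace Ω] (u : Ω → lp (fun _ : Fin d → ℤ => ℂ) 2)
    (hu : ∀ x, Measurable fun ω => u ω x) : StronglyMeasurable u := by
  refine stronglyMeasurable_of_tendsto (atTop : Filter (Finset (Fin d → ℤ)))
    (f := fun s ω => ∑ i ∈ s, u ω i • dl i) ?_ ?_
  · intro s
    exact Finset.stronglyMeasurable_fun_sum _ fun i _ => (hu i).stronglyMeasurable.smul_const _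
  · rw [tendsto_pi_nhds]
    intro ω
    exact dl_sum (u ω)

/-- neighbours -/
abbrev Nb (d : ℕ) := {n : Fin d → ℤ // ∑ i, |n i| = 1}

instance : Finite (Nb d) := by
  refine Set.Finite.to_subtype (s := {n : Fin d → ℤ | ∑ i, |n i| = 1}) ?_
  refine Set.Finite.subset (Set.finite_Icc (fun _ => (-1:ℤ)) (fun _ => (1:ℤ))) ?_
  intro n hn
  have : ∀ i, |n i| ≤ 1 := fun i => by
    rw [← (show ∑ i, |n i| = 1 from hn)]
    exact Finset.single_le_sum (f := fun i => |n i|) (fun i _ => abs_nonneg _) (Finset.mem_univ i)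
  exact ⟨fun i => (abs_le.1 (this i)).1, fun i => (abs_le.1 (this i)).2⟩

noncomputable instance : Fintype (Nb d) := Fintype.ofFinite _

/-- negation on neighbours -/
def nbneg : Nb d ≃ Nb d where
  toFun n := ⟨-n.1, by simpa using n.2⟩
  invFun n := ⟨-n.1, by simpa using n.2⟩
  left_inv n := by simp
  right_inv n := by simp

/-- formula -/
def IsH (H : lp (fun _ : Fin d → ℤ => ℂ) 2 →L[ℂ] lp (fun _ : Fin d → ℤ => ℂ) 2) (ω : (Fin d → ℤ) → ℝ) : Prop :=
  ∀ (f : lp (fun _ : Fin d → ℤ => ℂ) 2) (x : Fin d → ℤ),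
        H f x = 2 * (d : ℂ) * f x - ∑ n : Nb d, f (x + (n : Fin d → ℤ)) + (ω x : ℂ) * f x

lemma isH_dl {H : lp (fun _ : Fin d → ℤ => ℂ) 2 →L[ℂ] lp (fun _ : Fin d → ℤ => ℂ) 2} {ω : (Fin d → ℤ) → ℝ}
    (h : IsH H ω) (j : Fin d → ℤ) : H (dl j) = (2 * (d:ℂ) + ω j) • dl j - ∑ n : Nb d, dl (j - n.1) := by
  apply lp.ext
  funext x
  rw [h, lp.coeFn_sub, lp.coeFn_smul, lp.coeFn_sum, Pi.sub_apply, Pi.smul_apply, Finset.sum_apply]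
  simp only [dl_apply, eq_sub_iff_add_eq, smul_eq_mul]
  split_ifs with hx
  · rw [hx]; ring
  · ring

lemma isH_sa {H : lp (fun _ : Fin d → ℤ => ℂ) 2 →L[ℂ] lp (fun _ : Fin d → ℤ => ℂ) 2} {ω : (Fin d → ℤ) → ℝ}
    (h : IsH H ω) : IsSelfAdjoint H := by
  rw [ContinuousLinearMap.isSelfAdjoint_iff']
  ext f x
  rw [← inner_dl, ContinuousLinearMap.adjoint_inner_right, isH_dl h, h, inner_sub_left, inner_smul_left, sum_inner]
  simp only [inner_dl, map_add, map_mul, Complex.conj_ofReal, map_natCast]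
  have : ∑ n : Nb d, f (x - n.1) = ∑ n : Nb d, f (x + n.1) := by
    rw [← Equiv.sum_comp nbneg]
    refine Finset.sum_congr rfl fun n _ => ?_
    simp [nbneg]
  rw [this, show conj (2:ℂ) = 2 from map_ofNat _ 2]
  ring

lemma isH_pert {H H' : lp (fun _ : Fin d → ℤ => ℂ) 2 →L[ℂ] lp (fun _ : Fin d → ℤ => ℂ) 2} {ω : (Fin d → ℤ) → ℝ}
    (j : Fin d → ℤ) (t : ℝ)
    (h : IsH H (Function.update ω j 0)) (h' : IsH H' (Function.update ω j t)) : H' = pert H (dl j) t := by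
  ext f x
  rw [pert_apply, lp.coeFn_add, Pi.add_apply, lp.coeFn_smul, Pi.smul_apply, h, h', dl_apply, inner_dl]
  by_cases hx : x = j
  · subst hx; simp
  · simp [hx]

lemma conn (S : Set (Fin d → ℤ)) (j0 : Fin d → ℤ) (h0 : j0 ∈ S) (hS : ∀ i ∈ S, ∀ n : Nb d, i + n.1 ∈ S) (j : Fin d → ℤ) :
    j ∈ S := by
  let M : AddSubmonoid (Fin d → ℤ) :=
    { carrier := {v | ∀ i ∈ S, i + v ∈ S}
      zero_mem' := fun i hi => by simpa using hi
      add_mem' := fun {a b} ha hb i hi => by rw [← add_assoc]; exact hb _ (ha i hi) }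
  have hs : ∀ (k : Fin d) (e : ℤ), |e| = 1 → Pi.single k e ∈ M := by
    intro k e he i hi
    refine hS i hi ⟨Pi.single k e, ?_⟩
    rw [Finset.sum_eq_single k]
    · simpa using he
    · intro b _ hb; simp [hb]
    · simp
  have hs2 : ∀ (k : Fin d) (e : ℤ), Pi.single k e ∈ M := by
    intro k e
    obtain ⟨n, rfl | rfl⟩ := e.eq_nat_or_neg
    · have := AddSubmonoid.nsmul_mem M (hs k 1 (by simp)) n
      rw [← Pi.single_smul] at this
      simpa using this
    · have := AddSubmonoid.nsmul_mem M (hs k (-1) (by simp)) n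
      rw [← Pi.single_smul] at this
      simpa using this
  have h1 : j - j0 ∈ M := by
    rw [← Finset.univ_sum_single (j - j0)]
    exact AddSubmonoid.sum_mem _ fun k _ => hs2 k _
  have := h1 j0 h0
  simpa using this

end lat
end CyclicAux

open MeasureTheory

namespace CyclicAux
open Filter Topology ComplexConjugate

section prob

lemma meas_update {ι : Type*} [DecidableEq ι] (j : ι) :
    Measurable fun p : (ι → ℝ) × ℝ => Function.update p.1 j p.2 := by
  rw [measurable_pi_iff]
  intro i
  by_cases h : i = j
  · subst h; simpa using measurable_snd
  · simp only [Function.update_of_ne h]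
    exact (measurable_pi_apply i).comp measurable_fst

lemma map_update {ι : Type*} [DecidableEq ι] (μ : Measure ℝ) [IsProbabilityMeasure μ]
    (P : Measure (ι → ℝ)) [IsProbabilityMeasure P]
    (hP : ∀ (s : Finset ι) (t : ι → Set ℝ), (∀ i, MeasurableSet (t i)) →
      P {ω | ∀ i ∈ s, ω i ∈ t i} = ∏ i ∈ s, μ (t i)) (j : ι) :
    (P.prod μ).map (fun p : (ι → ℝ) × ℝ => Function.update p.1 j p.2) = P := by
  have h1 : P = Measure.infinitePi fun _ => μ := by
    apply Measure.eq_infinitePi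
    intro s t ht
    exact hP s t ht
  refine Eq.trans ?_ h1.symm
  apply Measure.eq_infinitePi
  intro s t ht
  rw [Measure.map_apply (meas_update j) (MeasurableSet.pi s.countable_toSet fun i _ => ht i)]
  by_cases hj : j ∈ s
  · have : ((fun p : (ι → ℝ) × ℝ => Function.update p.1 j p.2) ⁻¹' (s : Set ι).pi t) =
        {ω | ∀ i ∈ s.erase j, ω i ∈ t i} ×ˢ t j := by
      ext ⟨ω, x⟩
      simp only [Set.mem_preimage, Set.mem_pi, Finset.mem_coe, Set.mem_prod]
      constructor
      · intro h
        refine ⟨fun i hi => ?_, ?_⟩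
        · have := h i (Finset.mem_of_mem_erase hi)
          rwa [Function.update_of_ne (Finset.ne_of_mem_erase hi)] at this
        · simpa using h j hj
      · rintro ⟨h1, h2⟩ i hi
        by_cases hij : i = j
        · subst hij; simpa using h2
        · rw [Function.update_of_ne hij]; exact h1 i (Finset.mem_erase.2 ⟨hij, hi⟩)
    rw [this, Measure.prod_prod, hP _ _ ht, Finset.prod_erase_mul _ _ hj]
  · have : ((fun p : (ι → ℝ) × ℝ => Function.update p.1 j p.2) ⁻¹' (s : Set ι).pi t) =
        {ω | ∀ i ∈ s, ω i ∈ t i} ×ˢ Set.univ := by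
      ext ⟨ω, x⟩
      simp only [Set.mem_preimage, Set.mem_pi, Finset.mem_coe, Set.mem_prod, Set.mem_univ, and_true]
      refine forall₂_congr fun i hi => ?_
      rw [Function.update_of_ne (by rintro rfl; exact hj hi)]
    rw [this, Measure.prod_prod, hP _ _ ht, measure_univ, mul_one]

lemma ae_update {ι : Type*} [DecidableEq ι] (μ : Measure ℝ) [IsProbabilityMeasure μ]
    (P : Measure (ι → ℝ)) [IsProbabilityMeasure P]
    (hP : ∀ (s : Finset ι) (t : ι → Set ℝ), (∀ i, MeasurableSet (t i)) →
      P {ω | ∀ i ∈ s, ω i ∈ t i} = ∏ i ∈ s, μ (t i)) (j : ι) (B : Set (ι → ℝ)) (hB : MeasurableSet B)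
    (h : ∀ᵐ ω ∂P, ∀ᵐ t ∂μ, Function.update ω j t ∉ B) : P B = 0 := by
  rw [← map_update μ P hP j, Measure.map_apply (meas_update j) hB, Measure.measure_prod_null (meas_update j hB)]
  filter_upwards [h] with ω hω
  have h2 : μ {t | ¬ Function.update ω j t ∉ B} = 0 := hω
  simp only [not_not] at h2
  exact h2

end prob

theorem main_aux (d : ℕ) (c : ℝ) (hc : 0 < c)
    (μ : Measure ℝ)
    (hμ : μ = (ENNReal.ofReal (2 * c))⁻¹ • volume.restrict (Set.Icc (-c) c))
    (P : Measure ((Fin d → ℤ) → ℝ)) [IsProbabilityMeasure P]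
    (hP : ∀ (s : Finset (Fin d → ℤ)) (t : (Fin d → ℤ) → Set ℝ),
      (∀ i, MeasurableSet (t i)) →
      P {ω | ∀ i ∈ s, ω i ∈ t i} = ∏ i ∈ s, μ (t i))
    (H : ((Fin d → ℤ) → ℝ) →
      lp (fun _ : Fin d → ℤ => ℂ) 2 →L[ℂ] lp (fun _ : Fin d → ℤ => ℂ) 2)
    (hH : ∀ ω : (Fin d → ℤ) → ℝ, (∀ x, |ω x| ≤ c) → IsH (H ω) ω)
    (ψ : lp (fun _ : Fin d → ℤ => ℂ) 2) (hψ : ∀ᵐ ω ∂P, Cy (H ω) ψ = ⊤)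
    (φ : lp (fun _ : Fin d → ℤ => ℂ) 2) (hφ : φ ≠ 0) : ∀ᵐ ω ∂P, Cy (H ω) φ = ⊤ := by
  have hμp : IsProbabilityMeasure μ := by
    constructor
    rw [hμ]
    simp only [Measure.smul_apply, Measure.restrict_apply_univ, Real.volume_Icc, smul_eq_mul]
    rw [show c - -c = 2 * c by ring]
    exact ENNReal.inv_mul_cancel (by simp [hc]) ENNReal.ofReal_ne_top
  have hμv : μ ≪ volume := by
    rw [hμ]
    exact (Measure.smul_absolutelyContinuous).trans Measure.restrict_le_self.absolutelyContinuous
  have hμc : ∀ᵐ t ∂μ, |t| ≤ c := by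
    rw [hμ]
    apply Measure.ae_smul_measure
    filter_upwards [ae_restrict_mem measurableSet_Icc] with t ht
    exact abs_le.2 ht
  set Box : Set ((Fin d → ℤ) → ℝ) := {ω | ∀ x, |ω x| ≤ c} with hBox
  have hBoxm : MeasurableSet Box := by
    rw [hBox, Set.ofPred_forall]
    exact MeasurableSet.iInter fun x => measurableSet_le (measurable_pi_apply x).abs measurable_const
  have hBoxae : ∀ᵐ ω ∂P, ω ∈ Box := by
    change ∀ᵐ ω ∂P, ∀ x, |ω x| ≤ c
    rw [ae_all_iff]
    intro x
    have h1 := hP {x} (fun _ => {t | ¬ |t| ≤ c}) (fun _ => (measurableSet_le measurable_id.abs measurable_const).compl)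
    simp only [Finset.mem_singleton, forall_eq, Finset.prod_singleton] at h1
    rw [ae_iff]
    exact h1.trans hμc
  obtain ⟨Z, hZ, hZm, hZ0⟩ := exists_measurable_superset_of_null (show P {ω | ¬ Cy (H ω) ψ = ⊤} = 0 from hψ)
  classical
  -- measurability
  have hmeas : ∀ φ j, MeasurableSet {ω | ω ∈ Box ∧ dl j ∉ Cy (H ω) φ} := by
    intro φ j
    set u : ℕ → ((Fin d → ℤ) → ℝ) → lp (fun _ : Fin d → ℤ => ℂ) 2 := fun k ω => if ω ∈ Box then (H ω ^ k) φ else 0 with hu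
    have hum : ∀ k, StronglyMeasurable (u k) := by
      have : ∀ k x, Measurable fun ω => u k ω x := by
        intro k
        induction k with
        | zero =>
          intro x
          have : (fun ω => u 0 ω x) = fun ω => if ω ∈ Box then φ x else 0 := by
            funext ω; simp only [hu]; split_ifs <;> rfl
          rw [this]
          exact Measurable.ite hBoxm measurable_const measurable_const
        | succ k ih =>
          intro x
          have : (fun ω => u (k+1) ω x) = fun ω => 2 * (d : ℂ) * u k ω x - ∑ n : Nb d, u k ω (x + (n : Fin d → ℤ)) +
              (ω x : ℂ) * u k ω x := by
            funext ω
            simp only [hu]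
            split_ifs with h
            · rw [pow_succ', ContinuousLinearMap.mul_apply, hH ω h]
            · simp
          rw [this]
          refine ((measurable_const.mul (ih x)).sub (Finset.measurable_fun_sum _ fun n _ => ih _)).add ?_
          exact (Complex.measurable_ofReal.comp (measurable_pi_apply x)).mul (ih x)
      exact fun k => sm_coord _ (this k)
    have h1 := hBoxm.inter (meas_span u hum (dl j)).compl
    convert h1 using 1
    ext ω
    simp only [Set.mem_inter_iff]
    refine and_congr_right fun hω => ?_
    change _ ↔ ¬ (dl j ∈ (Submodule.span ℂ (Set.range fun k => u k ω)).topologicalClosure)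
    have : (fun k => u k ω) = fun k => (H ω ^ k) φ := by funext k; simp [hu, hω]
    rw [this]; rfl
  have hupd : ∀ ω ∈ Box, ∀ j t, |t| ≤ c → Function.update ω j t ∈ Box := by
    intro ω hω j t ht x
    by_cases h : x = j
    · subst h; simpa using ht
    · rw [Function.update_of_ne h]; exact hω x
  have step : ∀ φ j, (∀ ω ∈ Box, ∃ g ∈ Cy (H ω) (dl j), inner ℂ g φ ≠ 0) → ∀ᵐ ω ∂P, dl j ∈ Cy (H ω) φ := by
    intro φ j hg
    have hB := ae_update μ P hP j ({ω | ω ∈ Box ∧ dl j ∉ Cy (H ω) φ} ∩ Zᶜ) ((hmeas φ j).inter hZm.compl) ?_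
    · have hZae : ∀ᵐ ω ∂P, ω ∉ Z := by rw [ae_iff]; simpa using hZ0
      have hBae : ∀ᵐ ω ∂P, ω ∉ ({ω | ω ∈ Box ∧ dl j ∉ Cy (H ω) φ} ∩ Zᶜ) := measure_eq_zero_iff_ae_notMem.1 hB
      filter_upwards [hZae, hBae, hBoxae] with ω h1 h2 h3
      by_contra h4
      exact h2 ⟨⟨h3, h4⟩, h1⟩
    · filter_upwards [hBoxae] with ω hω
      have h0 := hupd ω hω j 0 (by simpa using hc.le)
      have hsa := isH_sa (hH _ h0)
      filter_upwards [hμv.ae_le (deloc hsa (dl j) φ ψ (hg _ h0)), hμc] with t ht htc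
      have hp := isH_pert j t (hH _ h0) (hH _ (hupd ω hω j t htc))
      rw [← hp] at ht
      rintro ⟨⟨_, h1⟩, h2⟩
      apply h1 (ht _)
      by_contra h3
      exact h2 (hZ h3)
  obtain ⟨j0, hj0⟩ : ∃ j, φ j ≠ 0 := by
    by_contra hcon
    push Not at hcon
    exact hφ (lp.ext (funext hcon))
  have s1 := step φ j0 fun ω _ => ⟨dl j0, Cy_self _ _, by rw [inner_dl]; exact hj0⟩
  have s2 : ∀ᵐ ω ∂P, ∀ i : Fin d → ℤ, ∀ n : Nb d, dl (i + n.1) ∈ Cy (H ω) (dl i) := by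
    rw [ae_all_iff]; intro i
    rw [ae_all_iff]; intro n
    refine step (dl i) (i + n.1) fun ω hω => ⟨H ω (dl (i + n.1)), Cy_inv _ _ (Cy_self _ _), ?_⟩
    have hn0 : n.1 ≠ 0 := by
      intro h
      have := n.2
      rw [h] at this; simp at this
    rw [sa_inner (isH_sa (hH ω hω)), inner_dl, hH ω hω]
    have h1 : ∀ m : Nb d, dl i (i + n.1 + m.1) = if m = nbneg n then (1:ℂ) else 0 := by
      intro m
      rw [dl_apply]
      congr 1
      rw [Subtype.ext_iff]
      change _ = (m.1 = -n.1)
      rw [add_assoc, add_eq_left, add_comm, ← eq_neg_iff_add_eq_zero]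
    simp only [h1, dl_apply]
    simp [hn0]
  filter_upwards [s1, s2] with ω h1 h2
  have hall : ∀ j, dl j ∈ Cy (H ω) φ := by
    refine conn {j | dl j ∈ Cy (H ω) φ} j0 h1 ?_
    intro i hi n
    exact Cy_le _ _ _ (Cy_closed _ _) (fun g hg => Cy_inv _ _ hg) hi (h2 i n)
  rw [eq_top_iff]
  intro f _
  refine (Cy_closed (H ω) φ).mem_of_tendsto (dl_sum f) (Eventually.of_forall fun s => ?_)
  exact Submodule.sum_mem _ fun i _ => Submodule.smul_mem _ _ (hall i)

end CyclicAux

open MeasureTheory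

/-- Fix `d ≥ 1` and `c > 0`.  Let `H_ω` be the discrete random
Schrödinger operator `(H_ω f)(x) = 2d f(x) − Σ_{‖n‖₁=1} f(x+n) + ω(x) f(x)` on the
complex Hilbert space `ℓ²(ℤᵈ)`.  Equip `Ω = ℤᵈ → ℝ` with the product probability
measure `ℙ = ⊗_i μ` of copies of the uniform measure `μ` on `[-c,c]` (characterized by
its finite-dimensional marginals).  If some `ψ` is cyclic for `H_ω` for ℙ-a.e. `ω`,
then every nonzero `φ` is cyclic for `H_ω` for ℙ-a.e. `ω`. -/
theorem stmt_1 (d : ℕ) (hd : 1 ≤ d) (c : ℝ) (hc : 0 < c)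
    (μ : Measure ℝ)
    (hμ : μ = (ENNReal.ofReal (2 * c))⁻¹ • volume.restrict (Set.Icc (-c) c))
    (ℙ : Measure ((Fin d → ℤ) → ℝ)) [IsProbabilityMeasure ℙ]
    (hℙ : ∀ (s : Finset (Fin d → ℤ)) (t : (Fin d → ℤ) → Set ℝ),
      (∀ i, MeasurableSet (t i)) →
      ℙ {ω | ∀ i ∈ s, ω i ∈ t i} = ∏ i ∈ s, μ (t i))
    (Hω : ((Fin d → ℤ) → ℝ) →
      lp (fun _ : Fin d → ℤ => ℂ) 2 →L[ℂ] lp (fun _ : Fin d → ℤ => ℂ) 2)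
    (hHω : ∀ ω : (Fin d → ℤ) → ℝ, (∀ x, |ω x| ≤ c) →
      ∀ (f : lp (fun _ : Fin d → ℤ => ℂ) 2) (x : Fin d → ℤ),
        Hω ω f x = 2 * (d : ℂ) * f x
          - ∑' n : {n : Fin d → ℤ // ∑ i, |n i| = 1}, f (x + (n : Fin d → ℤ))
          + (ω x : ℂ) * f x)
    (hψ : ∃ ψ : lp (fun _ : Fin d → ℤ => ℂ) 2,
      ∀ᵐ ω ∂ℙ,
        (Submodule.span ℂ
          (Set.range fun k : ℕ => (Hω ω ^ k) ψ)).topologicalClosure = ⊤) :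
    ∀ φ : lp (fun _ : Fin d → ℤ => ℂ) 2, φ ≠ 0 →
      ∀ᵐ ω ∂ℙ,
        (Submodule.span ℂ
          (Set.range fun k : ℕ => (Hω ω ^ k) φ)).topologicalClosure = ⊤ := by
  obtain ⟨ψ, hψ⟩ := hψ
  intro φ hφ
  exact CyclicAux.main_aux d c hc μ hμ ℙ hℙ Hω
    (fun ω hω f x => by rw [hHω ω hω f x, tsum_fintype]) ψ hψ φ hφ
end

section
/- Let −Δ be the free discrete Laplacian on ℓ²(ℤ²), (−Δf)(i,j) = 4f(i,j) − f(i+1,j) − f(i−1,j) − f(i,j+1) − f(i,j−1). Then the distance from δ_{(1,1)} to the closure of the linear span of the orbit {(−Δ)^n δ_{(0,0)} : n = 0, 1, 2, …} is at least √3/2. In particular, δ_{(0,0)} is not a cyclic vector for the free two dimensional discrete Laplacian. -/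
theorem aux_orbit_sym
    (negΔ : lp (fun _ : ℤ × ℤ => ℝ) 2 →L[ℝ] lp (fun _ : ℤ × ℤ => ℝ) 2)
    (hΔ : ∀ (f : lp (fun _ : ℤ × ℤ => ℝ) 2) (i j : ℤ),
      negΔ f (i, j) = 4 * f (i, j) - f (i + 1, j) - f (i - 1, j)
        - f (i, j + 1) - f (i, j - 1)) (n : ℕ) :
    ∀ i j : ℤ, ((negΔ ^ n) (lp.single 2 ((0 : ℤ), (0 : ℤ)) (1 : ℝ))) (-i, j)
        = ((negΔ ^ n) (lp.single 2 ((0 : ℤ), (0 : ℤ)) (1 : ℝ))) (i, j) ∧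
      ((negΔ ^ n) (lp.single 2 ((0 : ℤ), (0 : ℤ)) (1 : ℝ))) (i, -j)
        = ((negΔ ^ n) (lp.single 2 ((0 : ℤ), (0 : ℤ)) (1 : ℝ))) (i, j) := by
  induction n with
  | zero =>
    intro i j
    simp [lp.single_apply, Pi.single_apply, Prod.ext_iff]
  | succ n ih =>
    intro i j
    rw [pow_succ', ContinuousLinearMap.mul_apply, hΔ, hΔ, hΔ]
    generalize (negΔ ^ n) (lp.single 2 ((0 : ℤ), (0 : ℤ)) (1 : ℝ)) = f at ih
    have e1 : -i + 1 = -(i - 1) := by ring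
    have e2 : -i - 1 = -(i + 1) := by ring
    have e3 : -j + 1 = -(j - 1) := by ring
    have e4 : -j - 1 = -(j + 1) := by ring
    rw [e1, e2, e3, e4]
    simp only [(ih _ _).1, (ih _ _).2]
    constructor <;> ring

theorem aux_span_sym
    (negΔ : lp (fun _ : ℤ × ℤ => ℝ) 2 →L[ℝ] lp (fun _ : ℤ × ℤ => ℝ) 2)
    (hΔ : ∀ (f : lp (fun _ : ℤ × ℤ => ℝ) 2) (i j : ℤ),
      negΔ f (i, j) = 4 * f (i, j) - f (i + 1, j) - f (i - 1, j)
        - f (i, j + 1) - f (i, j - 1)) (g : lp (fun _ : ℤ × ℤ => ℝ) 2)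
    (hg : g ∈ Submodule.span ℝ (Set.range fun n : ℕ =>
            (negΔ ^ n) (lp.single 2 ((0 : ℤ), (0 : ℤ)) (1 : ℝ)))) :
    ∀ i j : ℤ, g (-i, j) = g (i, j) ∧ g (i, -j) = g (i, j) := by
  induction hg using Submodule.span_induction with
  | mem x hx =>
    obtain ⟨n, rfl⟩ := hx
    exact aux_orbit_sym negΔ hΔ n
  | zero => intro i j; simp
  | add x y _ _ hx hy =>
    intro i j
    simp [(hx i j).1, (hx i j).2, (hy i j).1, (hy i j).2]
  | smul a x _ hx =>
    intro i j
    simp [(hx i j).1, (hx i j).2]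

theorem aux_dist (g : lp (fun _ : ℤ × ℤ => ℝ) 2)
    (h : ∀ i j : ℤ, g (-i, j) = g (i, j) ∧ g (i, -j) = g (i, j)) :
    Real.sqrt 3 / 2 ≤ dist (lp.single 2 ((1 : ℤ), (1 : ℤ)) (1 : ℝ)) g := by
  rw [dist_eq_norm]
  have key := lp.sum_rpow_le_norm_rpow (p := 2) (by norm_num)
    (lp.single 2 ((1 : ℤ), (1 : ℤ)) (1 : ℝ) - g)
    ({(1, 1), (-1, 1), (1, -1), (-1, -1)} : Finset (ℤ × ℤ))
  have h1 := (h 1 1).1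
  have h2 := (h 1 1).2
  have h3 := (h 1 (-1)).1
  rw [h2] at h3
  rw [Finset.sum_insert (by decide), Finset.sum_insert (by decide),
    Finset.sum_insert (by decide), Finset.sum_singleton] at key
  simp [lp.single_apply, Pi.single_apply, Prod.ext_iff, h1, h2, h3] at key
  have h0 : 0 ≤ ‖lp.single 2 ((1 : ℤ), (1 : ℤ)) (1 : ℝ) - g‖ := norm_nonneg _
  have h4 : Real.sqrt 3 ^ 2 = 3 := Real.sq_sqrt (by norm_num)
  refine le_of_sq_le_sq ?_ h0
  nlinarith [sq_nonneg (4 * g (1, 1) - 1)]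

/-- Let `−Δ` be the free discrete Laplacian on `ℓ²(ℤ²)`.  Then the
distance from `δ₍₁,₁₎` to the closure of the span of the orbit
`{(−Δ)^n δ₍₀,₀₎ : n ∈ ℕ}` is at least `√3/2`.  In particular `δ₍₀,₀₎` is not a cyclic
vector for the free two-dimensional discrete Laplacian. -/
theorem stmt_15
    (negΔ : lp (fun _ : ℤ × ℤ => ℝ) 2 →L[ℝ] lp (fun _ : ℤ × ℤ => ℝ) 2)
    (hΔ : ∀ (f : lp (fun _ : ℤ × ℤ => ℝ) 2) (i j : ℤ),
      negΔ f (i, j) = 4 * f (i, j) - f (i + 1, j) - f (i - 1, j)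
        - f (i, j + 1) - f (i, j - 1)) :
    Real.sqrt 3 / 2 ≤
      Metric.infDist (lp.single 2 ((1 : ℤ), (1 : ℤ)) (1 : ℝ))
        ((Submodule.span ℝ
          (Set.range fun n : ℕ =>
            (negΔ ^ n) (lp.single 2 ((0 : ℤ), (0 : ℤ)) (1 : ℝ)))).topologicalClosure :
          Set (lp (fun _ : ℤ × ℤ => ℝ) 2)) ∧
    (Submodule.span ℝ
      (Set.range fun n : ℕ =>
        (negΔ ^ n) (lp.single 2 ((0 : ℤ), (0 : ℤ)) (1 : ℝ)))).topologicalClosure ≠ ⊤ := by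
  have main : Real.sqrt 3 / 2 ≤
      Metric.infDist (lp.single 2 ((1 : ℤ), (1 : ℤ)) (1 : ℝ))
        ((Submodule.span ℝ
          (Set.range fun n : ℕ =>
            (negΔ ^ n) (lp.single 2 ((0 : ℤ), (0 : ℤ)) (1 : ℝ)))).topologicalClosure :
          Set (lp (fun _ : ℤ × ℤ => ℝ) 2)) := by
    rw [Submodule.topologicalClosure_coe, Metric.infDist_closure]
    refine (Metric.le_infDist ⟨0, Submodule.zero_mem _⟩).2 ?_
    intro g hg
    exact aux_dist g (aux_span_sym negΔ hΔ g hg)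
  refine ⟨main, fun htop => ?_⟩
  rw [htop, Metric.infDist_zero_of_mem (by simp)] at main
  have : 0 < Real.sqrt 3 := Real.sqrt_pos.2 (by norm_num)
  linarith
end
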